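/- There exist a smooth function F : ℝ^(2×3) → ℝ (on 2×3 real matrices, identified with ℝ⁶) and constants 0 < γ ≤ Λ such that γ|Q−P|² ≤ F(Q) − F(P) − ∇F(P)·(Q−P) ≤ Λ|Q−P|² for all P, Q (so F is uniformly convex with bounded Hessian), and the Lipschitz map u = (u¹,u²) is a minimizer of ∫_{B₁} F(Du) dx, i.e. ∫_{B₁} F(Du + Dψ) dx ≥ ∫_{B₁} F(Du) dx for every ψ ∈ C_c^∞(B₁; ℝ²). -/

import Mathlib

open Real Set Metric MeasureTheory
open scoped RealInnerProductSpace

noncomputable section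

/-- `u₀(x) = (x₂² + x₃² − x₁²)/(√2·|x|)` (with value `0` at the origin, by `0`-division). -/
def u0 : EuclideanSpace ℝ (Fin 3) → ℝ :=
  fun x => ((x 1) ^ 2 + (x 2) ^ 2 - (x 0) ^ 2) / (Real.sqrt 2 * ‖x‖)

/-- `u¹(x₁,x₂,x₃) = u₀(x₁/2, x₂, x₃)`. -/
def u1 : EuclideanSpace ℝ (Fin 3) → ℝ :=
  fun x => u0 ((WithLp.equiv 2 (Fin 3 → ℝ)).symm ![x 0 / 2, x 1, x 2])

/-- `u²(x₁,x₂,x₃) = u₀(x₃/2, x₂, x₁)`. -/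
def u2 : EuclideanSpace ℝ (Fin 3) → ℝ :=
  fun x => u0 ((WithLp.equiv 2 (Fin 3 → ℝ)).symm ![x 2 / 2, x 1, x 0])

/-- `u = (u¹, u²) : ℝ³ → ℝ²`. -/
def uu : EuclideanSpace ℝ (Fin 3) → EuclideanSpace ℝ (Fin 2) :=
  fun x => (WithLp.equiv 2 (Fin 2 → ℝ)).symm ![u1 x, u2 x]

/-- The (a.e. defined) Jacobian matrix of a map `ℝ³ → ℝ²`, viewed as an element of
`ℝ^(2×3)` with the Frobenius (Euclidean) inner product. -/
def Du (v : EuclideanSpace ℝ (Fin 3) → EuclideanSpace ℝ (Fin 2))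
    (x : EuclideanSpace ℝ (Fin 3)) : EuclideanSpace ℝ (Fin 2 × Fin 3) :=
  (WithLp.equiv 2 (Fin 2 × Fin 3 → ℝ)).symm
    (fun p => fderiv ℝ v x (EuclideanSpace.single p.2 1) p.1)

section
open Real Set Metric MeasureTheory
open scoped RealInnerProductSpace Topology Convolution

section A1
variable {E : Type*} [NormedAddCommGroup E] [NormedSpace ℝ E]
variable {G : Type*} [NormedAddCommGroup G] [NormedSpace ℝ G]

lemma lipAux {w : E → G} (hw : Differentiable ℝ w) {L : ℝ} {s : Set E} (hs : Convex ℝ s)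
    (hL : ∀ P ∈ s, ∀ Q ∈ s, ‖fderiv ℝ w Q - fderiv ℝ w P‖ ≤ L * ‖Q - P‖) (hL0 : 0 ≤ L)
    {P Q : E} (hP : P ∈ s) (hQ : Q ∈ s) :
    ‖w Q - w P - fderiv ℝ w P (Q - P)‖ ≤ L * ‖Q - P‖ ^ 2 := by
  have hseg : segment ℝ P Q ⊆ s := hs.segment_subset hP hQ
  have := Convex.norm_image_sub_le_of_norm_fderiv_le' (𝕜 := ℝ) (f := w) (s := segment ℝ P Q)
    (φ := fderiv ℝ w P) (C := L * ‖Q - P‖) (x := P) (y := Q)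
    (fun x _ => hw x) (fun x hx => ?_) (convex_segment P Q) (left_mem_segment ℝ P Q)
    (right_mem_segment ℝ P Q)
  · calc _ ≤ _ := this
      _ = _ := by ring
  · refine (hL P hP x (hseg hx)).trans ?_
    gcongr
    have := norm_sub_le_of_mem_segment hx
    simpa [norm_sub_rev] using this

lemma cvxGrad {g : E → ℝ} (hg : ConvexOn ℝ univ g) {P : E} (hd : DifferentiableAt ℝ g P) (Q : E) :
    g P + fderiv ℝ g P (Q - P) ≤ g Q := by
  have h1 : ConvexOn ℝ univ (fun t : ℝ => g (P + t • (Q - P))) := by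
    refine ⟨convex_univ, fun x _ y _ a b ha hb hab => ?_⟩
    have := hg.2 (mem_univ (P + x • (Q - P))) (mem_univ (P + y • (Q - P))) ha hb hab
    have hb' : b = 1 - a := by linarith
    subst hb'
    refine le_of_eq_of_le (congrArg g ?_) this
    simp only [smul_eq_mul]
    module
  have h2 : HasDerivAt (fun t : ℝ => g (P + t • (Q - P))) (fderiv ℝ g P (Q - P)) 0 := by
    have hd' : HasFDerivAt g (fderiv ℝ g P) (P + (0:ℝ) • (Q - P)) := by
      simpa using hd.hasFDerivAt
    have hl : HasDerivAt (fun t : ℝ => P + t • (Q - P)) (Q - P) 0 := by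
      simpa using ((hasDerivAt_id (0:ℝ)).smul_const (Q - P)).const_add P
    exact hd'.comp_hasDerivAt (0:ℝ) hl
  have := h1.le_slope_of_hasDerivAt (mem_univ (0:ℝ)) (mem_univ (1:ℝ)) one_pos h2
  simp [slope_def_field] at this
  rw [map_sub]
  linarith
end A1
end

section
open Real Set Metric MeasureTheory
open scoped RealInnerProductSpace Topology Convolution

section A2
variable {E : Type*} [NormedAddCommGroup E] [InnerProductSpace ℝ E] [FiniteDimensional ℝ E]
  [MeasurableSpace E] [BorelSpace E]

/-- mollification -/
noncomputable def mol (ρ g : E → ℝ) (x : E) : ℝ := ∫ t, ρ t * g (x - t)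

lemma mol_apply (ρ g : E → ℝ) (x : E) : mol ρ g x = ∫ t, ρ t * g (x - t) := rfl

lemma mol_conv (ρ g : E → ℝ) :
    mol ρ g = (convolution ρ g (ContinuousLinearMap.lsmul ℝ ℝ) (volume : Measure E)) := rfl

lemma mol_int {ρ g : E → ℝ} (hρ : Continuous ρ) (hc : HasCompactSupport ρ) (hg : Continuous g) (x : E) :
    Integrable (fun t => ρ t * g (x - t)) := by
  apply Continuous.integrable_of_hasCompactSupport
  · fun_prop
  · exact hc.mul_right

lemma mol_convex {ρ g : E → ℝ} (hρ : Continuous ρ) (hc : HasCompactSupport ρ) (h0 : ∀ t, 0 ≤ ρ t)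
    (hg : Continuous g) (hcv : ConvexOn ℝ univ g) : ConvexOn ℝ univ (mol ρ g) := by
  refine ⟨convex_univ, fun x _ y _ a b ha hb hab => ?_⟩
  simp only [mol_apply, smul_eq_mul]
  rw [← integral_const_mul, ← integral_const_mul, ← integral_add]
  · refine integral_mono (mol_int hρ hc hg _) (((mol_int hρ hc hg _).const_mul _).add
      ((mol_int hρ hc hg _).const_mul _)) fun t => ?_
    have := hcv.2 (mem_univ (x - t)) (mem_univ (y - t)) ha hb hab
    have e : a • (x - t) + b • (y - t) = a • x + b • y - t := by
      have hb' : b = 1 - a := by linarith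
      subst hb'
      module
    rw [e] at this
    simp only [smul_eq_mul] at this ⊢
    nlinarith [h0 t, mul_le_mul_of_nonneg_left this (h0 t)]
  · exact (mol_int hρ hc hg _).const_mul _
  · exact (mol_int hρ hc hg _).const_mul _

lemma mol_fderiv_lip {ρ g : E → ℝ} (hρ : ContDiff ℝ 1 ρ) (hc : HasCompactSupport ρ) 
    (hg : Continuous g) {K : ℝ} (hK : ∀ x y, |g x - g y| ≤ K * ‖x - y‖) :
    ∃ L, 0 ≤ L ∧ ∀ P Q, ‖fderiv ℝ (mol ρ g) Q - fderiv ℝ (mol ρ g) P‖ ≤ L * ‖Q - P‖ := by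
  set L := ∫ t, ‖fderiv ℝ ρ t‖
  have hK0 : ∀ x y : E, 0 ≤ K * ‖x - y‖ := fun x y => (abs_nonneg _).trans (hK x y)
  refine ⟨L * |K|, by positivity, fun P Q => ?_⟩
  have hcd : Continuous (fderiv ℝ ρ) := hρ.continuous_fderiv (by simp)
  have hi : ∀ x, Integrable (fun t => g (x - t) • fderiv ℝ ρ t) := fun x => by
    apply Continuous.integrable_of_hasCompactSupport
    · exact (hg.comp (continuous_const.sub continuous_id)).smul hcd
    · exact (hc.fderiv ℝ).mono (fun t ht h => ht (by simp only [h, smul_zero]))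
  have hd : ∀ x, fderiv ℝ (mol ρ g) x = ∫ t, g (x - t) • fderiv ℝ ρ t := by
    intro x
    rw [mol_conv, (hc.hasFDerivAt_convolution_left (ContinuousLinearMap.lsmul ℝ ℝ) hρ
      hg.locallyIntegrable x).fderiv, convolution_def]
    congr 1
    ext t v
    simp [mul_comm]
  rw [hd, hd, ← integral_sub (hi _) (hi _)]
  refine (norm_integral_le_of_norm_le (g := fun t => (|K| * ‖Q - P‖) * ‖fderiv ℝ ρ t‖) ?_ ?_).trans ?_
  · refine (Continuous.integrable_of_hasCompactSupport (by fun_prop) ?_).const_mul _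
    exact (hc.fderiv ℝ).norm
  · refine Filter.Eventually.of_forall fun t => ?_
    rw [← sub_smul, norm_smul]
    gcongr
    have := hK (Q - t) (P - t)
    rw [sub_sub_sub_cancel_right] at this
    refine this.trans ?_
    gcongr
    exact le_abs_self K
  · rw [integral_const_mul]
    apply le_of_eq; ring

lemma mol_approx {ρ h : E → ℝ} (hρ : Continuous ρ) (hc : HasCompactSupport ρ) (h0 : ∀ t, 0 ≤ ρ t)
    (h1 : ∫ t, ρ t = 1) (hh : ContDiff ℝ 1 h) (hch : HasCompactSupport h) {ε : ℝ}
    (hε : ∀ t, ρ t ≠ 0 → ∀ P Q, ‖(fderiv ℝ h Q - fderiv ℝ h (Q - t)) - (fderiv ℝ h P - fderiv ℝ h (P - t))‖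
      ≤ ε * ‖Q - P‖) (P Q : E) :
    ‖fderiv ℝ (fun x => h x - mol ρ h x) Q - fderiv ℝ (fun x => h x - mol ρ h x) P‖ ≤ ε * ‖Q - P‖ := by
  have hcd : Continuous (fderiv ℝ h) := hh.continuous_fderiv (by simp)
  have hiρ : Integrable ρ := hρ.integrable_of_hasCompactSupport hc
  have hi : ∀ x, Integrable (fun t => ρ t • fderiv ℝ h (x - t)) := fun x => by
    apply Continuous.integrable_of_hasCompactSupport
    · exact hρ.smul (hcd.comp (continuous_const.sub continuous_id))
    · exact hc.mono (fun t ht h => ht (by simp only [h, zero_smul]))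
  have hi2 : ∀ x, Integrable (fun t => ρ t • fderiv ℝ h x) := fun x => hiρ.smul_const _
  have hm : ∀ x, HasFDerivAt (mol ρ h) (∫ t, ρ t • fderiv ℝ h (x - t)) x := by
    intro x
    have := hch.hasFDerivAt_convolution_right (μ := (volume : Measure E))
      (ContinuousLinearMap.lsmul ℝ ℝ) (hρ.locallyIntegrable) hh x
    rw [convolution_def] at this
    rw [mol_conv]
    exact this
  have hd : ∀ x, fderiv ℝ (fun x => h x - mol ρ h x) x = ∫ t, ρ t • (fderiv ℝ h x - fderiv ℝ h (x - t)) := by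
    intro x
    refine ((hh.differentiable (by simp) x).hasFDerivAt.sub (hm x)).fderiv.trans ?_
    simp only [smul_sub]
    rw [integral_sub (hi2 x) (hi x), integral_smul_const, h1, one_smul]
  have hi3 : ∀ x, Integrable (fun t => ρ t • (fderiv ℝ h x - fderiv ℝ h (x - t))) := fun x => by
    simp only [smul_sub]; exact (hi2 x).sub (hi x)
  rw [hd, hd, ← integral_sub (hi3 _) (hi3 _)]
  refine (norm_integral_le_of_norm_le (g := fun t => ρ t * (ε * ‖Q - P‖)) (hiρ.mul_const _) ?_).trans ?_
  · refine Filter.Eventually.of_forall fun t => ?_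
    rw [← smul_sub, norm_smul, Real.norm_of_nonneg (h0 t)]
    by_cases ht : ρ t = 0
    · simp [ht]
    · exact mul_le_mul_of_nonneg_left (hε t ht P Q) (h0 t)
  · rw [integral_mul_const, h1, one_mul]

lemma d2_unif {h : E → ℝ} (hh : ContDiff ℝ (⊤ : ℕ∞) h) (hch : HasCompactSupport h) {ε : ℝ} (hε : 0 < ε) :
    ∃ δ > 0, ∀ t : E, ‖t‖ < δ → ∀ P Q : E,
      ‖(fderiv ℝ h Q - fderiv ℝ h (Q - t)) - (fderiv ℝ h P - fderiv ℝ h (P - t))‖ ≤ ε * ‖Q - P‖ := by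
  have h1 : ContDiff ℝ 1 (fderiv ℝ h) := hh.fderiv_right (by norm_num; exact WithTop.coe_le_coe.2 le_top)
  have h2 : Continuous (fderiv ℝ (fderiv ℝ h)) := h1.continuous_fderiv (by simp)
  have hu := ((hch.fderiv ℝ).fderiv ℝ).uniformContinuous_of_continuous h2
  obtain ⟨δ, hδ, H⟩ := (Metric.uniformContinuous_iff (α := E) (β := E →L[ℝ] E →L[ℝ] ℝ)).1 hu ε hε
  refine ⟨δ, hδ, fun t ht P Q => ?_⟩
  have hdf : Differentiable ℝ (fderiv ℝ h) := h1.differentiable (by simp)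
  have hd2 : ∀ x, HasFDerivAt (fun x => fderiv ℝ h x - fderiv ℝ h (x - t))
      (fderiv ℝ (fderiv ℝ h) x - fderiv ℝ (fderiv ℝ h) (x - t)) x := fun x => by
    refine (hdf x).hasFDerivAt.sub ?_
    have := (hdf (x - t)).hasFDerivAt.comp x ((hasFDerivAt_id x).sub_const t)
    rw [ContinuousLinearMap.comp_id] at this
    exact this
  refine Convex.norm_image_sub_le_of_norm_hasFDerivWithin_le (𝕜 := ℝ) (s := univ)
    (f := fun x => fderiv ℝ h x - fderiv ℝ h (x - t))
    (fun x _ => (hd2 x).hasFDerivWithinAt) (fun x _ => ?_) convex_univ (mem_univ P) (mem_univ Q)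
  rw [← dist_eq_norm]
  refine (H ?_).le
  rw [dist_eq_norm]; simpa using ht

end A2
end

section
open Real Set Metric MeasureTheory
open scoped RealInnerProductSpace Topology Convolution

section A3
variable {E : Type*} [NormedAddCommGroup E] [InnerProductSpace ℝ E] [FiniteDimensional ℝ E]
  [MeasurableSpace E] [BorelSpace E]

/-- sup of affine minorants -/
lemma sup_affine {h : E → ℝ} (hh : ContDiff ℝ (⊤ : ℕ∞) h) {K : Set E} (hK : IsCompact K)
    (hne : K.Nonempty) (hcv : ∀ P ∈ K, ∀ Q ∈ K, h P + fderiv ℝ h P (Q - P) ≤ h Q) :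
    ∃ g : E → ℝ, ∃ L : ℝ, ConvexOn ℝ univ g ∧ (∀ x y, |g x - g y| ≤ L * ‖x - y‖) ∧
      ∀ x ∈ K, g x = h x := by
  have hdc : Continuous (fderiv ℝ h) := hh.continuous_fderiv (by simp)
  obtain ⟨L, hL⟩ := hK.exists_bound_of_continuousOn hdc.continuousOn
  have : Nonempty K := hne.to_subtype
  obtain ⟨x0, hx0⟩ := hne
  have hL0 : 0 ≤ L := (norm_nonneg _).trans (hL x0 hx0)
  have hbdd : ∀ P, BddAbove (range fun x : K => h x + fderiv ℝ h x (P - x)) := by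
    intro P
    have hc : ContinuousOn (fun x => h x + fderiv ℝ h x (P - x)) K := by
      have := hh.continuous
      exact (this.add (hdc.clm_apply (continuous_const.sub continuous_id))).continuousOn
    have := hK.bddAbove_image hc
    rwa [image_eq_range] at this
  set g : E → ℝ := fun P => ⨆ x : K, (h x + fderiv ℝ h x (P - x)) with hgdef
  have hlip : ∀ x y, g x ≤ g y + L * ‖x - y‖ := by
    intro x y
    refine ciSup_le fun z => ?_
    have h1 := le_ciSup (hbdd y) z
    have h2 : fderiv ℝ h z (x - z) = fderiv ℝ h z (y - z) + fderiv ℝ h z (x - y) := by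
      rw [← map_add]; congr 1; abel
    have h3 : fderiv ℝ h z (x - y) ≤ L * ‖x - y‖ := by
      refine (le_abs_self _).trans ?_
      refine ((fderiv ℝ h z).le_opNorm _).trans ?_
      gcongr
      exact hL z z.2
    simp only [hgdef] at h1 ⊢
    linarith
  refine ⟨g, L, ⟨convex_univ, fun x _ y _ a b ha hb hab => ?_⟩, fun x y => ?_, fun x hx => ?_⟩
  · refine ciSup_le fun z => ?_
    have h1 := mul_le_mul_of_nonneg_left (le_ciSup (hbdd x) z) ha
    have h2 := mul_le_mul_of_nonneg_left (le_ciSup (hbdd y) z) hb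
    have e : a • x + b • y - (z:E) = a • (x - z) + b • (y - z) := by
      have hb' : b = 1 - a := by linarith
      subst hb'
      module
    rw [e, map_add, map_smul, map_smul]
    simp only [smul_eq_mul] at h1 h2 ⊢
    have hb' : b = 1 - a := by linarith
    subst hb'
    simp only [hgdef]
    nlinarith
  · have h1 := hlip x y
    have h2 := hlip y x
    rw [norm_sub_rev] at h2
    rw [abs_le]; constructor <;> linarith
  · apply le_antisymm
    · exact ciSup_le fun z => hcv z z.2 x hx
    · have := le_ciSup (hbdd x) ⟨x, hx⟩
      simp only [sub_self, map_zero, add_zero] at this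
      exact this

theorem ext0 {h : E → ℝ} (hh : ContDiff ℝ (⊤ : ℕ∞) h) (hch : HasCompactSupport h) {Sg : Set E}
    (hSg : IsCompact Sg) (hne : Sg.Nonempty) {r c : ℝ} (hr : 0 < r) (hc : 0 < c)
    (hcv : ∀ P ∈ cthickening r Sg, ∀ Q ∈ cthickening r Sg, h P + fderiv ℝ h P (Q - P) ≤ h Q) :
    ∃ F : E → ℝ, ∃ γ Λ : ℝ, ContDiff ℝ (⊤ : ℕ∞) F ∧ 0 < γ ∧ γ ≤ Λ ∧
      (∀ P Q, γ * ‖Q - P‖ ^ 2 ≤ F Q - F P - fderiv ℝ F P (Q - P) ∧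
        F Q - F P - fderiv ℝ F P (Q - P) ≤ Λ * ‖Q - P‖ ^ 2) ∧
      ∀ P ∈ Sg, fderiv ℝ F P = fderiv ℝ (fun x => h x + c * ‖x‖ ^ 2) P := by
  obtain ⟨g, Lg, hgc, hgl, hgK⟩ := sup_affine hh (hSg.cthickening (r := r))
    (hne.mono (self_subset_cthickening _)) hcv
  have hgcont : Continuous g := by
    have : LipschitzWith (Lg.toNNReal) g := LipschitzWith.of_dist_le_mul fun x y => by
      rw [Real.dist_eq, dist_eq_norm]
      refine (hgl x y).trans ?_
      gcongr
      exact Real.le_coe_toNNReal Lg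
    exact this.continuous
  obtain ⟨δ, hδ, hδh⟩ := d2_unif hh hch (half_pos hc)
  set δ' := min δ (r / 2) with hδ'
  have hδ'0 : 0 < δ' := lt_min hδ (half_pos hr)
  let φ : ContDiffBump (0 : E) := ⟨δ' / 2, δ', half_pos hδ'0, half_lt_self hδ'0⟩
  set ρ : E → ℝ := φ.normed volume with hρdef
  have hρ : ContDiff ℝ (⊤ : ℕ∞) ρ := φ.contDiff_normed
  have hρ0 : ∀ t, 0 ≤ ρ t := φ.nonneg_normed
  have hρ1 : ∫ t, ρ t = 1 := φ.integral_normed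
  have hρc : HasCompactSupport ρ := φ.hasCompactSupport_normed
  have hρs : ∀ t, ρ t ≠ 0 → ‖t‖ < δ' := fun t ht => by
    have : t ∈ Function.support ρ := ht
    rw [hρdef, φ.support_normed_eq] at this
    simpa using this
  have hρ1' : ContDiff ℝ 1 ρ := hρ.of_le (by exact_mod_cast le_top)
  have hh1' : ContDiff ℝ 1 h := hh.of_le (by exact_mod_cast le_top)
  have hmg : ContDiff ℝ (⊤ : ℕ∞) (mol ρ g) := by
    rw [mol_conv]
    exact hρc.contDiff_convolution_left _ hρ hgcont.locallyIntegrable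
  have hmh : ContDiff ℝ (⊤ : ℕ∞) (mol ρ h) := by
    rw [mol_conv]
    exact hρc.contDiff_convolution_left _ hρ hh.continuous.locallyIntegrable
  have hcvx := mol_convex hρ.continuous hρc hρ0 hgcont hgc
  obtain ⟨L, hL0, hL⟩ := mol_fderiv_lip hρ1' hρc hgcont hgl
  have happ := mol_approx hρ.continuous hρc hρ0 hρ1 hh1' hch (ε := c / 2)
    (fun t ht => hδh t ((hρs t ht).trans_le (min_le_left _ _)))
  set k : E → ℝ := fun x => h x - mol ρ h x with hk
  have hks : ContDiff ℝ (⊤ : ℕ∞) k := hh.sub hmh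
  have hns : ContDiff ℝ (⊤ : ℕ∞) (fun x : E => c * ‖x‖ ^ 2) := contDiff_const.mul (contDiff_norm_sq ℝ)
  have top0 : ((⊤ : ℕ∞) : WithTop ℕ∞) ≠ 0 := by simp
  have hFd : ∀ P, HasFDerivAt (fun x => mol ρ g x + k x + c * ‖x‖ ^ 2)
      (fderiv ℝ (mol ρ g) P + fderiv ℝ k P + c • (2 • (innerSL ℝ P))) P := fun P => by
    refine ((hmg.differentiable top0 P).hasFDerivAt.add (hks.differentiable top0 P).hasFDerivAt).add ?_
    have := (hasStrictFDerivAt_norm_sq P).hasFDerivAt.const_mul c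
    exact this
  refine ⟨fun x => mol ρ g x + k x + c * ‖x‖ ^ 2, c / 2, L + c / 2 + c, (hmg.add hks).add hns,
    half_pos hc, by linarith, fun P Q => ?_, fun P hP => ?_⟩
  · rw [(hFd P).fderiv]
    have h1 := cvxGrad hcvx (hmg.differentiable top0 P) Q
    have h2 := lipAux (hmg.differentiable top0) convex_univ (fun P _ Q _ => hL P Q) hL0
      (mem_univ P) (mem_univ Q)
    have h3 := lipAux (hks.differentiable top0) convex_univ (fun P _ Q _ => happ P Q) 
      (half_pos hc).le (mem_univ P) (mem_univ Q)
    rw [Real.norm_eq_abs, abs_le] at h2 h3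
    have h4 : c * ‖Q‖ ^ 2 = c * ‖P‖ ^ 2 + c * (2 * ⟪P, Q - P⟫) + c * ‖Q - P‖ ^ 2 := by
      have : Q = P + (Q - P) := by abel
      conv_lhs => rw [this]
      rw [norm_add_sq_real]; ring
    simp only [ContinuousLinearMap.add_apply, ContinuousLinearMap.smul_apply, innerSL_apply_apply, smul_eq_mul,
      nsmul_eq_mul]
    push_cast
    constructor <;> linarith
  · apply Filter.EventuallyEq.fderiv_eq
    filter_upwards [ball_mem_nhds P (half_pos hr)] with x hx
    have : mol ρ g x = mol ρ h x := by
      rw [mol_apply, mol_apply]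
      congr 1
      ext t
      by_cases ht : ρ t = 0
      · simp [ht]
      · rw [hgK]
        apply mem_cthickening_of_dist_le _ P _ _ hP
        have h1 := hρs t ht
        have h2 : δ' ≤ r / 2 := min_le_right _ _
        rw [mem_ball, dist_eq_norm] at hx
        rw [dist_eq_norm]
        have : x - t - P = (x - P) - t := by abel
        rw [this]
        refine (norm_sub_le _ _).trans ?_
        linarith
    simp only [hk, this]; ring
end A3
end

section
open Real Set Metric MeasureTheory
open scoped RealInnerProductSpace Topology Convolution

section A4
variable {V : Type*} [NormedAddCommGroup V] [NormedSpace ℝ V] [FiniteDimensional ℝ V]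
variable {G : Type*} [NormedAddCommGroup G] [NormedSpace ℝ G]

lemma top_le_one' : (1 : WithTop ℕ∞) ≤ ((⊤ : ℕ∞) : WithTop ℕ∞) := by exact_mod_cast le_top

lemma smooth_lip {w : V → G} (hw : ContDiff ℝ 1 w) (R : ℝ) :
    ∃ C, 0 ≤ C ∧ ∀ P ∈ closedBall (0:V) R, ∀ Q ∈ closedBall (0:V) R, ‖w Q - w P‖ ≤ C * ‖Q - P‖ := by
  have : ProperSpace V := FiniteDimensional.proper_rclike ℝ V
  obtain ⟨C, hC⟩ := (isCompact_closedBall (0:V) R).exists_bound_of_continuousOn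
    (hw.continuous_fderiv (by simp)).continuousOn
  refine ⟨max C 0, le_max_right _ _, fun P hP Q hQ => ?_⟩
  exact Convex.norm_image_sub_le_of_norm_fderiv_le (𝕜 := ℝ) (fun x _ => hw.differentiable (by simp) x)
    (fun x hx => (hC x hx).trans (le_max_left _ _)) (convex_closedBall (0:V) R) hP hQ

lemma smooth_taylor {w : V → G} (hw : ContDiff ℝ (⊤ : ℕ∞) w) (R : ℝ) :
    ∃ C, 0 ≤ C ∧ ∀ P ∈ closedBall (0:V) R, ∀ Q ∈ closedBall (0:V) R,
      ‖w Q - w P - fderiv ℝ w P (Q - P)‖ ≤ C * ‖Q - P‖ ^ 2 := by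
  have h1 : ContDiff ℝ 1 (fderiv ℝ w) := hw.fderiv_right (by norm_num; exact WithTop.coe_le_coe.2 le_top)
  obtain ⟨C, hC0, hC⟩ := smooth_lip h1 R
  exact ⟨C, hC0, fun P hP Q hQ => lipAux (hw.differentiable (by simp)) (convex_closedBall (0:V) R)
    hC hC0 hP hQ⟩

lemma ext_arith {c C1 C2 M η k σ d w : ℝ} (hc : 0 < c) (hC1 : 1 ≤ C1) 
    (hM : M = C1 ^ 2 / (2 * c) + c / 2) (hk : k = c / (4 * C1 ^ 2)) (hη : η * C2 * (1 + 2 * M) ≤ k / 2)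
    (hw : w ≤ d + C1 * σ) (hw0 : 0 ≤ w) (hd0 : 0 ≤ d) (hσ0 : 0 ≤ σ) :
    k / 2 * w ^ 2 ≤ c * σ ^ 2 - C1 * σ * d + M * d ^ 2 - C2 * w ^ 2 * η - 2 * M * (η * (C2 * w ^ 2)) := by
  have hk0 : 0 < k := by rw [hk]; positivity
  have e1 : k * C1 ^ 2 = c / 4 := by rw [hk]; field_simp
  have e2 : k ≤ c / 4 := by nlinarith [mul_nonneg hk0.le (by nlinarith : (0:ℝ) ≤ C1 ^ 2 - 1)]
  have h1 : w ^ 2 ≤ 2 * d ^ 2 + 2 * C1 ^ 2 * σ ^ 2 := by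
    nlinarith [sq_nonneg (d - C1 * σ), mul_nonneg (by linarith : (0:ℝ) ≤ C1) hσ0]
  have h2 : c / 2 * σ ^ 2 + c / 2 * d ^ 2 ≤ c * σ ^ 2 - C1 * σ * d + M * d ^ 2 := by
    have : c * σ ^ 2 - C1 * σ * d + M * d ^ 2 - (c / 2 * σ ^ 2 + c / 2 * d ^ 2)
      = (c * σ - C1 * d) ^ 2 / (2 * c) := by rw [hM]; field_simp; ring
    have h' : 0 ≤ (c * σ - C1 * d) ^ 2 / (2 * c) := by positivity
    linarith
  have h3 : k * w ^ 2 ≤ c / 2 * σ ^ 2 + c / 2 * d ^ 2 := by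
    have := mul_le_mul_of_nonneg_left h1 hk0.le
    have h4 : k * d ^ 2 ≤ c / 4 * d ^ 2 := mul_le_mul_of_nonneg_right e2 (sq_nonneg d)
    have h5 : k * (2 * C1 ^ 2 * σ ^ 2) = c / 2 * σ ^ 2 := by
      calc _ = 2 * (k * C1 ^ 2) * σ ^ 2 := by ring
        _ = _ := by rw [e1]; ring
    nlinarith
  have h6 := mul_le_mul_of_nonneg_right hη (sq_nonneg w)
  nlinarith
end A4

section A5
variable {V : Type*} [NormedAddCommGroup V] [NormedSpace ℝ V] [FiniteDimensional ℝ V]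
variable {E : Type*} [NormedAddCommGroup E] [InnerProductSpace ℝ E] [FiniteDimensional ℝ E]
  [MeasurableSpace E] [BorelSpace E]

theorem extMain {S : Set V} (hS : IsCompact S) (hne : S.Nonempty) {f : V → ℝ} {A Y : V → E} {X : E → V}
    (hf : ContDiff ℝ (⊤ : ℕ∞) f) (hA : ContDiff ℝ (⊤ : ℕ∞) A) (hY : ContDiff ℝ (⊤ : ℕ∞) Y)
    (hX : ContDiff ℝ (⊤ : ℕ∞) X) (hXY : ∀ x ∈ S, X (Y x) = x)
    (hXS : ∀ x ∈ S, ∀ᶠ P in 𝓝 (Y x), X P ∈ S) {c : ℝ} (hc : 0 < c)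
    (hD : ∀ x ∈ S, ∀ y ∈ S, c * ‖y - x‖ ^ 2 ≤ f y - f x - ⟪A x, Y y - Y x⟫) :
    ∃ F : E → ℝ, ∃ γ Λ : ℝ, ContDiff ℝ (⊤ : ℕ∞) F ∧ 0 < γ ∧ γ ≤ Λ ∧
      (∀ P Q, γ * ‖Q - P‖ ^ 2 ≤ F Q - F P - fderiv ℝ F P (Q - P) ∧
        F Q - F P - fderiv ℝ F P (Q - P) ≤ Λ * ‖Q - P‖ ^ 2) ∧
      ∀ x ∈ S, fderiv ℝ F (Y x) = innerSL ℝ (A x) := by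
  have top0 : ((⊤ : ℕ∞) : WithTop ℕ∞) ≠ 0 := by simp
  set Sg := Set.image Y (S) with hSg
  have hSgc : IsCompact Sg := hS.image hY.continuous
  -- neighbourhood where `X ∈ S`
  set U := interior {P | X P ∈ S} with hU
  have hUX : ∀ P ∈ U, X P ∈ S := fun P hP => (interior_subset (s := {P | X P ∈ S}) hP : _)
  have hUS : Sg ⊆ U := by
    rintro _ ⟨x, hx, rfl⟩
    exact mem_interior_iff_mem_nhds.2 (hXS x hx)
  obtain ⟨r0, hr0, hr0U⟩ := hSgc.exists_cthickening_subset_open isOpen_interior hUS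
  set a := fun P => A (X P) with ha
  set y := fun P => Y (X P) with hy
  set φ := fun P => f (X P) with hφ
  set e := fun P => P - y P with he
  have has : ContDiff ℝ (⊤ : ℕ∞) a := hA.comp hX
  have hys : ContDiff ℝ (⊤ : ℕ∞) y := hY.comp hX
  have hφs : ContDiff ℝ (⊤ : ℕ∞) φ := hf.comp hX
  have hes : ContDiff ℝ (⊤ : ℕ∞) e := contDiff_id.sub hys
  -- constants
  obtain ⟨R0, hR0⟩ := hS.isBounded.subset_closedBall (0:V)
  obtain ⟨CA, hCA0, hCA⟩ := smooth_lip (hA.of_le top_le_one') R0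
  obtain ⟨CY, hCY0, hCY⟩ := smooth_lip (hY.of_le top_le_one') R0
  obtain ⟨R, hR⟩ := (hSgc.cthickening (r := r0)).isBounded.subset_ball (0:E)
  have hR' := hR.trans ball_subset_closedBall
  obtain ⟨Ca, hCa0, hCa⟩ := smooth_taylor has R
  obtain ⟨Ce, hCe0, hCe⟩ := smooth_taylor hes R
  set C1 := max 1 (max CA CY) with hC1
  have hC1CA : CA ≤ C1 := (le_max_left _ _).trans (le_max_right _ _)
  have hC1CY : CY ≤ C1 := (le_max_right _ _).trans (le_max_right _ _)
  have hC11 : 1 ≤ C1 := le_max_left _ _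
  have hC10 : 0 < C1 := by linarith
  set C2 := max Ca Ce with hC2
  have hC20 : 0 ≤ C2 := hCa0.trans (le_max_left _ _)
  obtain ⟨M, hM⟩ : ∃ M, M = C1 ^ 2 / (2 * c) + c / 2 := ⟨_, rfl⟩
  have hM0 : 0 < M := by rw [hM]; positivity
  obtain ⟨k, hk⟩ : ∃ k, k = c / (4 * C1 ^ 2) := ⟨_, rfl⟩
  have hk0 : 0 < k := by rw [hk]; positivity
  obtain ⟨η, hη0, hη⟩ : ∃ η > 0, η * C2 * (1 + 2 * M) ≤ k / 2 := by
    refine ⟨k / 2 / ((C2 + 1) * (1 + 2 * M)), by positivity, ?_⟩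
    rw [div_mul_eq_mul_div, div_mul_eq_mul_div, div_le_iff₀ (by positivity)]
    have : (0:ℝ) ≤ k / 2 * (1 + 2 * M) := by positivity
    nlinarith
  obtain ⟨r1, hr1, hr1U⟩ := hSgc.exists_cthickening_subset_open (t := {P | ‖e P‖ < η})
    (isOpen_lt hes.continuous.norm continuous_const) (by
      rintro _ ⟨x, hx, rfl⟩
      simp only [he, hy, mem_ofPred_eq, hXY x hx, sub_self, norm_zero]; exact hη0)
  set r := min r0 r1 with hr
  have hrpos : 0 < r := lt_min hr0 hr1
  have hr_0 : cthickening r Sg ⊆ cthickening r0 Sg := cthickening_mono (min_le_left _ _) _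
  have hr_1 : cthickening r Sg ⊆ cthickening r1 Sg := cthickening_mono (min_le_right _ _) _
  -- the local function
  set Fl := fun P => φ P + ⟪a P, e P⟫ + M * ‖e P‖ ^ 2 with hFl
  have hFls : ContDiff ℝ (⊤ : ℕ∞) Fl :=
    (hφs.add (has.inner ℝ hes)).add (contDiff_const.mul (hes.norm_sq ℝ))
  have hDφ : ∀ P ∈ U, ∀ w, fderiv ℝ φ P w = ⟪a P, fderiv ℝ y P w⟫ := by
    intro P hP w
    have hmin : IsLocalMin (fun Q => φ Q - ⟪a P, y Q⟫) P := by
      filter_upwards [isOpen_interior.mem_nhds hP] with Q hQ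
      have := hD _ (hUX _ hP) _ (hUX _ hQ)
      rw [inner_sub_right] at this
      have h0 : 0 ≤ c * ‖X Q - X P‖ ^ 2 := by positivity
      simp only [hφ, ha, hy]
      linarith
    have hd : HasFDerivAt (fun Q => φ Q - ⟪a P, y Q⟫)
        (fderiv ℝ φ P - (innerSL ℝ (a P)).comp (fderiv ℝ y P)) P :=
      (hφs.differentiable top0 P).hasFDerivAt.sub
        ((innerSL ℝ (a P)).hasFDerivAt.comp P (hys.differentiable top0 P).hasFDerivAt)
    have := hmin.hasFDerivAt_eq_zero hd
    have h2 := congrArg (fun l => l w) this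
    simp at h2
    linarith
  have hDe : ∀ P w, fderiv ℝ e P w = w - fderiv ℝ y P w := by
    intro P w
    have : HasFDerivAt e (ContinuousLinearMap.id ℝ E - fderiv ℝ y P) P :=
      (hasFDerivAt_id P).sub (hys.differentiable top0 P).hasFDerivAt
    rw [this.fderiv]; simp
  have hDFl : ∀ P ∈ U, ∀ w, fderiv ℝ Fl P w =
      ⟪a P, w⟫ + ⟪fderiv ℝ a P w, e P⟫ + 2 * M * ⟪e P, fderiv ℝ e P w⟫ := by
    intro P hP w
    have h1 := (hφs.differentiable top0 P).hasFDerivAt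
    have h2 := (has.differentiable top0 P).hasFDerivAt.inner ℝ (hes.differentiable top0 P).hasFDerivAt
    have h3 := ((hes.differentiable top0 P).hasFDerivAt.norm_sq).const_mul M
    have h4 := (h1.add h2).add h3
    have h5 : fderiv ℝ Fl P = _ := h4.fderiv
    rw [h5]
    simp [fderivInnerCLM_apply, hDφ P hP w, hDe, inner_sub_right]
    ring
  have key : ∀ P ∈ cthickening r Sg, ∀ Q ∈ cthickening r Sg,
      k / 2 * ‖Q - P‖ ^ 2 ≤ Fl Q - Fl P - fderiv ℝ Fl P (Q - P) := by
    intro P hP Q hQ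
    have hPU := hr0U (hr_0 hP)
    have hQU := hr0U (hr_0 hQ)
    have hPS : X P ∈ S := hUX _ hPU
    have hQS : X Q ∈ S := hUX _ hQU
    have hPη : ‖e P‖ < η := hr1U (hr_1 hP)
    have b1 := hD _ hPS _ hQS
    have b2 : ‖a Q - a P‖ ≤ C1 * ‖X Q - X P‖ :=
      (hCA _ (hR0 hPS) _ (hR0 hQS)).trans (by gcongr)
    have b3 : ‖y Q - y P‖ ≤ C1 * ‖X Q - X P‖ :=
      (hCY _ (hR0 hPS) _ (hR0 hQS)).trans (by gcongr)
    have b4 : ‖a Q - a P - fderiv ℝ a P (Q - P)‖ ≤ C2 * ‖Q - P‖ ^ 2 :=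
      (hCa _ (hR' (hr_0 hP)) _ (hR' (hr_0 hQ))).trans (by gcongr; exact le_max_left _ _)
    have b5 : ‖e Q - e P - fderiv ℝ e P (Q - P)‖ ≤ C2 * ‖Q - P‖ ^ 2 :=
      (hCe _ (hR' (hr_0 hP)) _ (hR' (hr_0 hQ))).trans (by gcongr; exact le_max_right _ _)
    have b6 : ‖Q - P‖ ≤ ‖e Q - e P‖ + C1 * ‖X Q - X P‖ := by
      have : Q - P = (e Q - e P) + (y Q - y P) := by simp only [he]; abel
      conv_lhs => rw [this]
      exact (norm_add_le _ _).trans (by gcongr)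
    have c1 : -(C1 * ‖X Q - X P‖ * ‖e Q - e P‖) ≤ ⟪a Q - a P, e Q - e P⟫ := by
      have := neg_le_of_abs_le (abs_real_inner_le_norm (a Q - a P) (e Q - e P))
      refine le_trans (neg_le_neg ?_) this
      gcongr
    have c2 : -(C2 * ‖Q - P‖ ^ 2 * η) ≤ ⟪a Q - a P - fderiv ℝ a P (Q - P), e P⟫ := by
      have := neg_le_of_abs_le (abs_real_inner_le_norm (a Q - a P - fderiv ℝ a P (Q - P)) (e P))
      refine le_trans (neg_le_neg ?_) this
      gcongr
    have c3 : -(η * (C2 * ‖Q - P‖ ^ 2)) ≤ ⟪e P, e Q - e P - fderiv ℝ e P (Q - P)⟫ := by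
      have := neg_le_of_abs_le (abs_real_inner_le_norm (e P) (e Q - e P - fderiv ℝ e P (Q - P)))
      refine le_trans (neg_le_neg ?_) this
      gcongr
    have c3' := mul_le_mul_of_nonneg_left c3 (by positivity : (0:ℝ) ≤ 2 * M)
    have ar := ext_arith (c := c) (C2 := C2) hc hC11 hM hk hη b6 (norm_nonneg _) (norm_nonneg _) (norm_nonneg _)
    have id : Fl Q - Fl P - fderiv ℝ Fl P (Q - P) =
        (f (X Q) - f (X P) - ⟪A (X P), Y (X Q) - Y (X P)⟫) + ⟪a Q - a P, e Q - e P⟫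
        + M * ‖e Q - e P‖ ^ 2 + ⟪a Q - a P - fderiv ℝ a P (Q - P), e P⟫
        + 2 * M * ⟪e P, e Q - e P - fderiv ℝ e P (Q - P)⟫ := by
      rw [hDFl P hPU]
      have h1 : ⟪a P, Q - P⟫ = ⟪a P, e Q⟫ - ⟪a P, e P⟫ + ⟪a P, y Q⟫ - ⟪a P, y P⟫ := by
        have : Q - P = e Q - e P + y Q - y P := by simp only [he]; abel
        conv_lhs => rw [this]
        simp only [inner_add_right, inner_sub_right]
      rw [h1]
      simp only [hFl, inner_sub_right, inner_sub_left, norm_sub_sq_real]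
      simp only [hφ, ha, hy, ← real_inner_self_eq_norm_sq, real_inner_comm (e P) (e Q)]
      ring
    rw [id]
    linarith
  -- cutoff
  have hRpos : 0 < R := by
    obtain ⟨x, hx⟩ := hne
    have := hR (self_subset_cthickening _ ⟨x, hx, rfl⟩)
    exact (norm_nonneg _).trans_lt (by simpa using this)
  let χ : ContDiffBump (0 : E) := ⟨R, R + 1, hRpos, by linarith⟩
  set h := fun P => χ P * (Fl P - k / 2 * ‖P‖ ^ 2) with hh
  have hhs : ContDiff ℝ (⊤ : ℕ∞) h := χ.contDiff.mul
    (hFls.sub (contDiff_const.mul (contDiff_norm_sq ℝ)))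
  have hhc : HasCompactSupport h := χ.hasCompactSupport.mul_right
  have hloc : ∀ P ∈ cthickening r0 Sg, h =ᶠ[𝓝 P] fun P => Fl P - k / 2 * ‖P‖ ^ 2 := by
    intro P hP
    filter_upwards [isOpen_ball.mem_nhds (hR hP)] with Q hQ
    simp only [hh]
    rw [χ.one_of_mem_closedBall (ball_subset_closedBall hQ), one_mul]
  have hdl : ∀ P, HasFDerivAt (fun P => Fl P - k / 2 * ‖P‖ ^ 2)
      (fderiv ℝ Fl P - (k / 2) • (2 • (innerSL ℝ P))) P := fun P =>
    (hFls.differentiable top0 P).hasFDerivAt.sub ((hasStrictFDerivAt_norm_sq P).hasFDerivAt.const_mul (k/2))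
  obtain ⟨F, γ, Λ, hF1, hF2, hF3, hF4, hF5⟩ := ext0 hhs hhc hSgc (hne.image Y) hrpos (half_pos hk0) (by
    intro P hP Q hQ
    rw [(hloc P (hr_0 hP)).fderiv_eq, (hloc P (hr_0 hP)).eq_of_nhds, (hloc Q (hr_0 hQ)).eq_of_nhds,
      (hdl P).fderiv]
    have h4 : k / 2 * ‖Q‖ ^ 2 = k / 2 * ‖P‖ ^ 2 + k / 2 * (2 * ⟪P, Q - P⟫) + k / 2 * ‖Q - P‖ ^ 2 := by
      have : Q = P + (Q - P) := by abel
      conv_lhs => rw [this]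
      rw [norm_add_sq_real]; ring
    have := key P hP Q hQ
    simp only [sub_apply, smul_apply, innerSL_apply_apply, smul_eq_mul, nsmul_eq_mul]
    push_cast
    linarith)
  refine ⟨F, γ, Λ, hF1, hF2, hF3, hF4, fun x hx => ?_⟩
  have hxS : Y x ∈ Sg := ⟨x, hx, rfl⟩
  rw [hF5 _ hxS]
  have : (fun z => h z + k / 2 * ‖z‖ ^ 2) =ᶠ[𝓝 (Y x)] Fl := by
    filter_upwards [hloc _ (self_subset_cthickening _ hxS)] with z hz
    rw [hz]; ring
  rw [this.fderiv_eq]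
  ext w
  rw [hDFl _ (hUS hxS)]
  simp [he, ha, hy, hXY x hx]
end A5
end

section
open Real Set Metric MeasureTheory

lemma polyI {x y c : ℝ} (hx : x ^ 2 ≤ 1) (hy : y ^ 2 ≤ 1) (hc : c = 0 ∨ (c = 1/50 ∧ x ^ 2 ≤ 2/5)) :
    0 ≤ (3 - x^2 - x*y - y^2)^2 * (8 - (x+y)^2)
      - 3 * (1 - x^2) * (2 - x^2) * (6 - x^2 - 2*x*y - 3*y^2) - 8 * c := by
  obtain ⟨X, hX⟩ : ∃ X, X = 1 - x^2 := ⟨_, rfl⟩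
  obtain ⟨Y, hY⟩ : ∃ Y, Y = 1 - y^2 := ⟨_, rfl⟩
  obtain ⟨Q, hQ⟩ : ∃ Q, Q = 3 - x^2 - x*y - y^2 := ⟨_, rfl⟩
  obtain ⟨q, hq⟩ : ∃ q, q = 3/2*(X+Y) := ⟨_, rfl⟩
  have hX0 : 0 ≤ X := by linarith
  have hX1 : X ≤ 1 := by nlinarith [sq_nonneg x]
  have hY0 : 0 ≤ Y := by linarith
  have hq0 : 0 ≤ q := by rw [hq]; linarith
  have hQq : q ≤ Q := by rw [hq, hQ, hX, hY]; nlinarith [sq_nonneg (x - y)]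
  have hR : 4 + 2*X + 2*Y ≤ 8 - (x+y)^2 := by rw [hX, hY]; nlinarith [sq_nonneg (x - y)]
  have e1 : 6 - x^2 - 2*x*y - 3*y^2 = 2*Q + Y - X := by rw [hX, hY, hQ]; ring
  have e2 : 2 - x^2 = 1 + X := by rw [hX]; ring
  rw [e1, e2, ← hQ, ← hX]
  have s1 : Q^2 * (4 + 2*X + 2*Y) ≤ Q^2 * (8 - (x+y)^2) := by gcongr
  have s2 : 0 ≤ (Q - q) * ((Q + q) * (4 + 2*X+2*Y) - 6*X*(1+X)) := by
    apply mul_nonneg (by linarith)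
    have : 2 * q * (4 + 2*X+2*Y) ≤ (Q + q) * (4 + 2*X+2*Y) := by
      apply mul_le_mul_of_nonneg_right <;> linarith
    rw [hq] at this
    have h3 : 0 ≤ X * Y := by positivity
    rw [hq]
    nlinarith [sq_nonneg X, sq_nonneg Y]
  have s3 : 8 * c ≤ q^2 * (4+2*X+2*Y) - 3*X*(1+X)*(2*q+Y-X) := by
    have e : q^2 * (4+2*X+2*Y) - 3*X*(1+X)*(2*q+Y-X) = 3/2*X^2*(2-X) + (6*X*Y+9*Y^2+3/2*X^2*Y+27/2*X*Y^2+9/2*Y^3) := by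
      rw [hq]; ring
    rw [e]
    have p1 : 0 ≤ 6*X*Y+9*Y^2+3/2*X^2*Y+27/2*X*Y^2+9/2*Y^3 := by positivity
    have p2 : 8 * c ≤ 3/2*X^2*(2-X) := by
      rcases hc with rfl | ⟨rfl, hx'⟩
      · have : 0 ≤ X^2*(2-X) := mul_nonneg (sq_nonneg _) (by linarith)
        linarith
      · have : 3/5 ≤ X := by linarith
        nlinarith [mul_nonneg (sub_nonneg.2 this) (sub_nonneg.2 hX1), sq_nonneg X]
    linarith
  nlinarith

lemma bernA2 {m : ℝ} (h1 : (0) ≤ m) (h2 : m ≤ (2)) : 0 ≤ m*(12-18*m+28*m^2-14*m^3+2*m^4) + 5/12*m*(-36+42*m-16*m^2+2*m^3)+25/144*(56+1/4-111*m+36*m^2-m^3) := by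
  rcases le_total m (1) with h3 | h3
  · obtain ⟨s, hs⟩ : ∃ s, s = m - (0) := ⟨_, rfl⟩
    obtain ⟨t, ht⟩ : ∃ t, t = (1) - m := ⟨_, rfl⟩
    have hs0 : 0 ≤ s := by linarith
    have ht0 : 0 ≤ t := by linarith
    have e : m*(12-18*m+28*m^2-14*m^3+2*m^4) + 5/12*m*(-36+42*m-16*m^2+2*m^3)+25/144*(56+1/4-111*m+36*m^2-m^3) = (625/64)*s^0*t^5 + (5099/192)*s^1*t^4 + (1375/96)*s^2*t^3 + (703/288)*s^3*t^2 + (3541/576)*s^4*t^1 + (1865/576)*s^5*t^0 := by rw [hs, ht]; ring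
    rw [e]; positivity
  · obtain ⟨s, hs⟩ : ∃ s, s = m - (1) := ⟨_, rfl⟩
    obtain ⟨t, ht⟩ : ∃ t, t = (2) - m := ⟨_, rfl⟩
    have hs0 : 0 ≤ s := by linarith
    have ht0 : 0 ≤ t := by linarith
    have e : m*(12-18*m+28*m^2-14*m^3+2*m^4) + 5/12*m*(-36+42*m-16*m^2+2*m^3)+25/144*(56+1/4-111*m+36*m^2-m^3) = (1865/576)*s^0*t^5 + (15109/576)*s^1*t^4 + (23839/288)*s^2*t^3 + (32201/288)*s^3*t^2 + (35057/576)*s^4*t^1 + (6241/576)*s^5*t^0 := by rw [hs, ht]; ring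
    rw [e]; positivity

lemma bernC0 {m : ℝ} (h1 : (9/25) ≤ m) (h2 : m ≤ (41/25)) : 0 ≤ m^2*(12-18*m+28*m^2-14*m^3+2*m^4) - 4/25 := by
  obtain ⟨s, hs⟩ : ∃ s, s = m - (9/25) := ⟨_, rfl⟩
  obtain ⟨t, ht⟩ : ∃ t, t = (41/25) - m := ⟨_, rfl⟩
  have hs0 : 0 ≤ s := by linarith
  have ht0 : 0 ≤ t := by linarith
  have e : m^2*(12-18*m+28*m^2-14*m^3+2*m^4) - 4/25 = (115403491/536870912)*s^0*t^6 + (796515177/268435456)*s^1*t^5 + (7895068365/536870912)*s^2*t^4 + (4876213295/134217728)*s^3*t^3 + (27534924365/536870912)*s^4*t^2 + (8401372777/268435456)*s^5*t^1 + (3428974691/536870912)*s^6*t^0 := by rw [hs, ht]; ring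
  rw [e]; positivity

lemma bernC1 {m : ℝ} (h1 : (9/25) ≤ m) (h2 : m ≤ (41/25)) : 0 ≤ m^3*((12-18*m+28*m^2-14*m^3+2*m^4)+5/24*(-36+42*m-16*m^2+2*m^3)) - 4/25*(m+5/12) := by
  obtain ⟨s, hs⟩ : ∃ s, s = m - (9/25) := ⟨_, rfl⟩
  obtain ⟨t, ht⟩ : ∃ t, t = (41/25) - m := ⟨_, rfl⟩
  have hs0 : 0 ≤ s := by linarith
  have ht0 : 0 ≤ t := by linarith
  have e : m^3*((12-18*m+28*m^2-14*m^3+2*m^4)+5/24*(-36+42*m-16*m^2+2*m^3)) - 4/25*(m+5/12) = (58902829/6442450944)*s^0*t^7 + (2569346197/6442450944)*s^1*t^6 + (8481010303/2147483648)*s^2*t^5 + (118693803485/6442450944)*s^3*t^4 + (306564704015/6442450944)*s^4*t^3 + (427685605591/6442450944)*s^5*t^2 + (255240911303/6442450944)*s^6*t^1 + (51243695671/6442450944)*s^7*t^0 := by rw [hs, ht]; ring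
  rw [e]; positivity

lemma bernC2 {m : ℝ} (h1 : (9/25) ≤ m) (h2 : m ≤ (41/25)) : 0 ≤ m^3*(m*(12-18*m+28*m^2-14*m^3+2*m^4) + 5/12*m*(-36+42*m-16*m^2+2*m^3)+25/144*(56+1/4-111*m+36*m^2-m^3)) - 4/25*(m+5/12)^2 := by
  obtain ⟨s, hs⟩ : ∃ s, s = m - (9/25) := ⟨_, rfl⟩
  obtain ⟨t, ht⟩ : ∃ t, t = (41/25) - m := ⟨_, rfl⟩
  have hs0 : 0 ≤ s := by linarith
  have ht0 : 0 ≤ t := by linarith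
  have e : m^3*(m*(12-18*m+28*m^2-14*m^3+2*m^4) + 5/12*m*(-36+42*m-16*m^2+2*m^3)+25/144*(56+1/4-111*m+36*m^2-m^3)) - 4/25*(m+5/12)^2 = (4932525295817/633318697598976)*s^0*t^8 + (11324483551733/79164837199872)*s^1*t^7 + (107197197452519/158329674399744)*s^2*t^6 + (68289324610331/79164837199872)*s^3*t^5 + (749915320371595/316659348799488)*s^4*t^4 + (1564077670118531/79164837199872)*s^5*t^3 + (6873399452936119/158329674399744)*s^6*t^2 + (2378803840769533/79164837199872)*s^7*t^1 + (4019450180005417/633318697598976)*s^8*t^0 := by rw [hs, ht]; ring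
  rw [e]; positivity

lemma polyII {m w c : ℝ} (hm0 : 0 ≤ m) (hm2 : m ≤ 2) (hw0 : 0 ≤ w) (hw1 : w ≤ 5/12)
    (hc : c = 0 ∨ (c = 1/50 ∧ 36/100 ≤ m ∧ m ≤ 164/100)) :
    8 * c * (m+w)^2 ≤ m * ((4+4*m-4*w-(m-w)^2)*m*(3-m)*(m^2*(3-m)-2*w^2*(3+w))
      -3*(2-m)*(1+2*m-m^2)*(m+w)^2*(4*m-m^2-8*w+2*m*w-3*w^2)) := by
  have h2m : 0 ≤ 2 - m := by linarith
  have d4 : 0 ≤ 18+69*m-62*m^2+13*m^3 := by nlinarith [mul_nonneg hm0 h2m, mul_nonneg (mul_nonneg hm0 h2m) hm0, sq_nonneg (m - 2)]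
  have d3 : 0 ≤ 48+144*m-136*m^2+2*m^3+10*m^4 + 9*m^2 := by
    nlinarith [mul_nonneg hm0 h2m, mul_nonneg (mul_nonneg hm0 h2m) hm0, sq_nonneg (m - 2), sq_nonneg (m * (m - 2)), sq_nonneg (m^2 - 3)]
  have d5 : 0 ≤ m*(6-2*m) := mul_nonneg hm0 (by linarith)
  obtain ⟨a, ha⟩ : ∃ a, a = 12-18*m+28*m^2-14*m^3+2*m^4 := ⟨_, rfl⟩
  obtain ⟨b, hb⟩ : ∃ b, b = -36+42*m-16*m^2+2*m^3 := ⟨_, rfl⟩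
  obtain ⟨k, hk⟩ : ∃ k, k = 56+1/4-111*m+36*m^2-m^3 := ⟨_, rfl⟩
  have main : m^2*(m*a+m*b*w+k*w^2) ≤ ((4+4*m-4*w-(m-w)^2)*m*(3-m)*(m^2*(3-m)-2*w^2*(3+w))
      -3*(2-m)*(1+2*m-m^2)*(m+w)^2*(4*m-m^2-8*w+2*m*w-3*w^2)) := by
    have e : ((4+4*m-4*w-(m-w)^2)*m*(3-m)*(m^2*(3-m)-2*w^2*(3+w))
      -3*(2-m)*(1+2*m-m^2)*(m+w)^2*(4*m-m^2-8*w+2*m*w-3*w^2)) - m^2*(m*a+m*b*w+k*w^2)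
      = w^5*(m*(6-2*m)) + w^4*(18+69*m-62*m^2+13*m^3) + w^3*(48+144*m-136*m^2+2*m^3+10*m^4 + 9*m^2)
        + 9*(m*w)^2*(5/12 - w) := by rw [ha, hb, hk]; ring
    have : 0 ≤ w^5*(m*(6-2*m)) + w^4*(18+69*m-62*m^2+13*m^3) + w^3*(48+144*m-136*m^2+2*m^3+10*m^4 + 9*m^2)
        + 9*(m*w)^2*(5/12 - w) := by
      have := sub_nonneg.2 hw1
      positivity
    linarith
  refine le_trans ?_ (mul_le_mul_of_nonneg_left main hm0)
  have hv : 0 ≤ 5/12 - w := by linarith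
  have bern : ∀ B0 B1 B2 : ℝ, 0 ≤ B0 → 0 ≤ B1 → 0 ≤ B2 → 
     0 ≤ B0 * (5/12 - w)^2 + 2 * B1 * (5/12 - w) * w + B2 * w^2 := by
    intro B0 B1 B2 h0 h1 h2; positivity
  rcases hc with rfl | ⟨rfl, h1, h2⟩
  · have a0 : 0 ≤ a := by
      rw [ha]; nlinarith [mul_nonneg hm0 h2m, mul_nonneg (mul_nonneg hm0 h2m) hm0, sq_nonneg (m^2 - 7/2*m+3/2), sq_nonneg (m^2-3*m), sq_nonneg (m-1), sq_nonneg (m*(m-2))]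
    have a1 : 0 ≤ a + 5/24*b := by
      rw [ha, hb]; nlinarith [mul_nonneg hm0 h2m, mul_nonneg (mul_nonneg hm0 h2m) hm0, sq_nonneg (m^2 - 7/2*m+3/2), sq_nonneg (m^2-3*m), sq_nonneg (m-1/4), sq_nonneg (m*(m-2))]
    have a2 : 0 ≤ m*a + 5/12*m*b+25/144*k := by
      rw [ha, hb, hk]; exact bernA2 (by linarith) (by linarith)
    have := bern _ _ _ (mul_nonneg hm0 a0) (mul_nonneg hm0 a1) a2
    have e : m*a+m*b*w+k*w^2 = 144/25*(m * a * (5/12 - w)^2 + 2 * (m * (a + 5/24*b)) * (5/12 - w) * w +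
      (m*a + 5/12*m*b+25/144*k) * w^2) := by ring
    have : 0 ≤ m*a+m*b*w+k*w^2 := by rw [e]; linarith
    simp only [mul_zero, zero_mul]
    positivity
  · have c0 := bernC0 (m := m) (by linarith) (by linarith)
    have c1 := bernC1 (m := m) (by linarith) (by linarith)
    have c2 := bernC2 (m := m) (by linarith) (by linarith)
    rw [← ha] at c0
    rw [← ha, ← hb] at c1
    rw [← ha, ← hb, ← hk] at c2
    have := bern _ _ _ (mul_nonneg (sq_nonneg m) c0) (mul_nonneg hm0 c1) c2
    have e : m * (m^2*(m*a+m*b*w+k*w^2)) - 8 * (1/50) * (m+w)^2 = 144/25*(m^2*(m^2*a-4/25) * (5/12 - w)^2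
      + 2 * (m * (m^3*(a + 5/24*b) - 4/25*(m+5/12))) * (5/12 - w) * w +
      (m^3*(m*a + 5/12*m*b+25/144*k)-4/25*(m+5/12)^2) * w^2) := by ring
    linarith

/-- the cubic profile -/
noncomputable def pp (x : ℝ) : ℝ := 3 * x - x ^ 3
noncomputable def clp (x : ℝ) : ℝ := max (-1) (min 1 x)
noncomputable def jc (x : ℝ) : ℝ := pp (clp x)
noncomputable def bb (x : ℝ) : ℝ := 3/4 * (2 - x ^ 2) * max 0 (1 - x ^ 2)
noncomputable def scD (x y E : ℝ) : ℝ :=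
  1/2 * (jc y - jc x) * (pp y - 1/2 * (jc y + jc x)) + bb x * ((1 + y ^ 2) * E - (y - x) ^ 2)

lemma clp_mid {x : ℝ} (h1 : -1 ≤ x) (h2 : x ≤ 1) : clp x = x := by
  unfold clp; rw [min_eq_right h2, max_eq_right h1]
lemma clp_top {x : ℝ} (h2 : 1 ≤ x) : clp x = 1 := by
  unfold clp; rw [min_eq_left h2, max_eq_right (by norm_num)]
lemma clp_bot {x : ℝ} (h2 : x ≤ -1) : clp x = -1 := by
  unfold clp; rw [min_eq_right (by linarith), max_eq_left h2]

lemma clp_neg (x : ℝ) : clp (-x) = -clp x := by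
  rcases le_total x 1 with h | h
  · rcases le_total (-1) x with h' | h'
    · rw [clp_mid h' h, clp_mid (by linarith) (by linarith)]
    · rw [clp_bot h', clp_top (by linarith)]; norm_num
  · rw [clp_top h, clp_bot (by linarith)]

lemma scD_neg (x y E : ℝ) : scD (-x) (-y) E = scD x y E := by
  simp only [scD, jc, clp_neg, pp, bb]; ring_nf

lemma scD_pos_aux {x y E c : ℝ} (hx : x ^ 2 ≤ 1) (hy1 : y ^ 2 ≤ 2) (hE : 0 ≤ E)
    (hEE : 2 * (y - x) ^ 2 ≤ E * (8 - (x + y) ^ 2)) (hc : c = 0 ∨ (c = 1/50 ∧ x ^ 2 ≤ 2/5)) 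
    {T : ℝ} (hT : scD x y E = 1/4 * T + 3/4 * (2 - x^2) * (1 - x^2) * ((1 + y ^ 2) * E - (y - x) ^ 2))
    (hpoly : 0 ≤ (8 - (x+y)^2) * T + (y - x)^2 * (- 3 * (1 - x^2) * (2 - x^2) * (6 - x^2 - 2*x*y - 3*y^2) - 8 * c)) :
    c * E ≤ scD x y E := by
  have hR : 0 < 8 - (x+y)^2 := by nlinarith [sq_nonneg (x - y)]
  have hco : 0 ≤ 3/4 * (2 - x^2) * (1 - x^2) * (1 + y^2) - c := by
    rcases hc with rfl | ⟨rfl, hx'⟩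
    · have h1 : 0 ≤ 2 - x^2 := by linarith
      have h2 : 0 ≤ 1 - x^2 := by linarith
      simp only [sub_zero]; positivity
    · nlinarith [sq_nonneg y, mul_nonneg (by nlinarith : 0 ≤ (2 - x^2) * (1 - x^2)) (sq_nonneg y)]
  have h3 := mul_le_mul_of_nonneg_left hEE hco
  have : 0 ≤ (8 - (x+y)^2) * (scD x y E - c * E) := by
    rw [hT]
    nlinarith
  have := nonneg_of_mul_nonneg_right this hR
  linarith

lemma scD_up {x y E c : ℝ} (hx : x ^ 2 ≤ 1) (hy : 1 ≤ y) (hy1 : y ^ 2 ≤ 2) (hE : 0 ≤ E)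
    (hEE : 2 * (y - x) ^ 2 ≤ E * (8 - (x + y) ^ 2)) (hc : c = 0 ∨ (c = 1/50 ∧ x ^ 2 ≤ 2/5)) :
    c * E ≤ scD x y E := by
  have hx1 : x ≤ 1 := by nlinarith
  have hx2 : -1 ≤ x := by nlinarith
  refine scD_pos_aux hx hy1 hE hEE hc (T := (1-x)^2*(2+x)*((1-x)^2*(2+x) - 2*(y-1)^2*(2+y))) ?_ ?_
  · simp only [scD, bb, jc, clp_mid hx2 hx1, clp_top hy, pp]
    rw [max_eq_right (by linarith)]
    ring
  · have hw : y - 1 ≤ 5/12 := by nlinarith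
    have := polyII (m := 1 - x) (w := y - 1) (c := c) (by linarith) (by linarith) (by linarith) hw (by
      rcases hc with h | ⟨h, h'⟩
      · exact Or.inl h
      · exact Or.inr ⟨h, by nlinarith, by nlinarith⟩)
    nlinarith

lemma scD_ge {x y E c : ℝ} (hx : x ^ 2 ≤ 2) (hy : y ^ 2 ≤ 2) (hE : 0 ≤ E)
    (hEE : 2 * (y - x) ^ 2 ≤ E * (8 - (x + y) ^ 2)) (hc : c = 0 ∨ (c = 1/50 ∧ x ^ 2 ≤ 2/5)) :
    c * E ≤ scD x y E := by
  rcases le_total (x ^ 2) 1 with hx1 | hx1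
  · rcases le_total (y ^ 2) 1 with hy1 | hy1
    · refine scD_pos_aux hx1 hy hE hEE hc (T := (y-x)^2*(3 - x^2 - x*y - y^2)^2) ?_ ?_
      · simp only [scD, bb, jc, clp_mid (by nlinarith : -1 ≤ x) (by nlinarith : x ≤ 1),
          clp_mid (by nlinarith : -1 ≤ y) (by nlinarith : y ≤ 1), pp]
        rw [max_eq_right (by linarith)]
        ring
      · have := mul_nonneg (sq_nonneg (y - x)) (polyI hx1 hy1 hc)
        nlinarith
    · rcases le_total 0 y with h | h
      · exact scD_up hx1 (by nlinarith) hy hE hEE hc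
      · rw [← scD_neg]
        exact scD_up (by simpa using hx1) (by nlinarith) (by simpa using hy) hE (by nlinarith)
          (by simpa using hc)
  · have hc0 : c = 0 := by
      rcases hc with h | ⟨-, h⟩
      · exact h
      · linarith
    subst hc0
    have key : ∀ x y : ℝ, 1 ≤ x → x ^ 2 ≤ 2 → y ^ 2 ≤ 2 → 0 ≤ scD x y E := by
      intro x y hx1 hx hy
      have hb : bb x = 0 := by
        unfold bb; rw [max_eq_left (by nlinarith)]; ring
      unfold scD
      rw [hb, zero_mul, add_zero]
      rcases le_total y 1 with h1 | h1
      · rcases le_total (-1) y with h2 | h2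
        · simp only [jc, clp_top hx1, clp_mid h2 h1]
          nlinarith [sq_nonneg (pp y - pp 1)]
        · simp only [jc, clp_top hx1, clp_bot h2, pp]
          nlinarith [mul_nonneg (by linarith : 0 ≤ -y) (by linarith : 0 ≤ 2 - y^2)]
      · simp only [jc, clp_top hx1, clp_top h1]; simp
    rw [zero_mul]
    rcases le_total 0 x with h | h
    · exact key x y (by nlinarith) hx hy
    · rw [← scD_neg]
      exact key _ _ (by nlinarith) (by simpa using hx) (by simpa using hy)
end

section
open Real Set Metric MeasureTheory
open scoped Topology

lemma hasDerivAt_pp (x : ℝ) : HasDerivAt pp (3 * (1 - x^2)) x := by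
  have h := ((hasDerivAt_id x).const_mul 3).sub ((hasDerivAt_id x).pow 3)
  refine (h.congr_deriv ?_)
  simp; ring

lemma hasDerivAt_jc (x : ℝ) : HasDerivAt jc (3 * max 0 (1 - x^2)) x := by
  have key : ∀ x : ℝ, 0 ≤ x → HasDerivAt jc (3 * max 0 (1 - x^2)) x := by
    intro x hx
    rcases lt_trichotomy x 1 with h | h | h
    · rw [max_eq_right (by nlinarith)]
      refine (hasDerivAt_pp x).congr_of_eventuallyEq ?_
      filter_upwards [Ioo_mem_nhds (by linarith : -1 < x) h] with y hy
      rw [jc, clp_mid hy.1.le hy.2.le]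
    · subst h
      rw [show (3:ℝ) * max 0 (1 - 1^2) = 0 by norm_num]
      have h1 : HasDerivWithinAt jc 0 (Iic 1) 1 := by
        have := (hasDerivAt_pp 1).hasDerivWithinAt (s := Iic (1:ℝ))
        rw [show (3:ℝ) * (1 - 1^2) = 0 by norm_num] at this
        refine this.congr_of_eventuallyEq ?_ (by rw [jc, clp_top le_rfl])
        filter_upwards [mem_nhdsWithin_of_mem_nhds (Ioi_mem_nhds (by norm_num : (-1:ℝ) < 1)),
          self_mem_nhdsWithin] with y hy hy2
        rw [jc, clp_mid (le_of_lt hy) hy2]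
      have h2 : HasDerivWithinAt jc 0 (Ici 1) 1 := by
        refine (hasDerivWithinAt_const (c := pp 1) (1:ℝ) (Ici (1:ℝ))).congr ?_ ?_
        · intro y hy; rw [jc, clp_top hy]
        · rw [jc, clp_top le_rfl]
      have := h1.union h2
      rwa [Iic_union_Ici, hasDerivWithinAt_univ] at this
    · rw [max_eq_left (by nlinarith), mul_zero]
      refine (hasDerivAt_const x (pp 1)).congr_of_eventuallyEq ?_
      filter_upwards [Ioi_mem_nhds h] with y hy
      rw [jc, clp_top (le_of_lt hy)]
  rcases le_total 0 x with h | h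
  · exact key x h
  · have h1 := key (-x) (by linarith)
    have h2 : jc = fun y => - jc (-y) := by
      ext y; simp only [jc, clp_neg, pp]; ring
    rw [h2]
    have := (h1.comp x (hasDerivAt_neg x)).neg
    refine this.congr_deriv ?_
    simp

/-- the rescaled cubic profile -/
noncomputable def PP (t : ℝ) : ℝ := 3 * t - 2 * t ^ 3
noncomputable def be0 (t : ℝ) : ℝ := 3/2 * max 0 (1 - 2 * t^2)
noncomputable def J0 (t : ℝ) : ℝ := jc (√2 * t) / √2
noncomputable def Ph0 (t : ℝ) : ℝ := J0 t * PP t - 1/2 * J0 t ^ 2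

lemma sq2 : √2 ^ 2 = (2:ℝ) := Real.sq_sqrt (by norm_num)
lemma s2pos : (0:ℝ) < √2 := by positivity

lemma PP_pp (t : ℝ) : PP t = pp (√2 * t) / √2 := by
  have h := sq2
  have h' := s2pos
  unfold PP pp
  field_simp
  rw [h]

lemma hasDerivAt_PP (t : ℝ) : HasDerivAt PP (3 - 6 * t^2) t := by
  have h := ((hasDerivAt_id t).const_mul 3).sub (((hasDerivAt_id t).pow 3).const_mul 2)
  refine (h.congr_deriv ?_)
  simp; ring

lemma hasDerivAt_J0 (t : ℝ) : HasDerivAt J0 (2 * be0 t) t := by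
  have h := ((hasDerivAt_jc (√2 * t)).comp t ((hasDerivAt_id t).const_mul √2)).div_const √2
  refine h.congr_deriv ?_
  have h' := s2pos
  simp only [be0, mul_pow, sq2]
  field_simp

lemma hasDerivAt_Ph0 (t : ℝ) : HasDerivAt Ph0 ((3 - 6*t^2) * J0 t) t := by
  have h := ((hasDerivAt_J0 t).mul (hasDerivAt_PP t)).sub (((hasDerivAt_J0 t).pow 2).const_mul (1/2))
  refine h.congr_deriv ?_
  have : be0 t * (PP t - J0 t) = 0 := by
    rcases le_total (2 * t^2) 1 with h | h
    · have hx : (√2 * t)^2 ≤ 1 := by rw [mul_pow, sq2]; exact h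
      have : PP t = J0 t := by
        rw [PP_pp, J0, jc, clp_mid (by nlinarith) (by nlinarith)]
      rw [this, sub_self, mul_zero]
    · rw [be0, max_eq_left (by linarith)]; ring
  simp
  linear_combination 2 * this

lemma antideriv {β : ℝ → ℝ} (h : ContDiff ℝ (⊤ : ℕ∞) β) :
    ∃ J : ℝ → ℝ, ContDiff ℝ (⊤ : ℕ∞) J ∧ ∀ t, HasDerivAt J (β t) t := by
  refine ⟨fun t => ∫ s in (0:ℝ)..t, β s, ?_, fun t => ?_⟩
  · have hd : ∀ t, HasDerivAt (fun t => ∫ s in (0:ℝ)..t, β s) (β t) t := fun t =>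
      intervalIntegral.integral_hasDerivAt_right (h.continuous.intervalIntegrable _ _)
        h.continuous.stronglyMeasurable.stronglyMeasurableAtFilter h.continuous.continuousAt
    rw [contDiff_infty_iff_deriv]
    refine ⟨fun t => (hd t).differentiableAt, ?_⟩
    rw [show deriv (fun t => ∫ s in (0:ℝ)..t, β s) = β from funext fun t => (hd t).deriv]
    exact h
  · exact intervalIntegral.integral_hasDerivAt_right (h.continuous.intervalIntegrable _ _)
        h.continuous.stronglyMeasurable.stronglyMeasurableAtFilter h.continuous.continuousAt

/-- constraint consequences -/
lemma constr {t τ E : ℝ} (ht : t^2 ≤ 1) (hτ : τ^2 ≤ 1) (h : (1 - E - t*τ)^2 ≤ (1 - t^2)*(1-τ^2)) :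
    (τ - t)^2 ≤ E * (2 - (t+τ)^2/2) ∧ 0 ≤ E ∧ (τ - t)^2 ≤ 2 * E := by
  have h1 : (τ - t)^2 ≤ E * (2 - 2*t*τ - E) := by nlinarith
  have hE0 : 0 ≤ E := by
    by_contra hE
    push Not at hE
    have : 0 < 2 - 2*t*τ - E := by nlinarith [sq_nonneg (t - τ)]
    nlinarith [mul_neg_of_neg_of_pos hE this, sq_nonneg (τ - t)]
  have hE1 : (τ - t)^2 / 2 ≤ E := by
    by_contra hE
    push Not at hE
    have a1 : (τ - t)^2 ≤ 2 - 2*t*τ := by nlinarith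
    have a2 : 0 < ((τ - t)^2/2 - E) * (2 - 2*t*τ - E - (τ - t)^2/2) := by
      apply mul_pos <;> linarith
    nlinarith [mul_nonneg (sq_nonneg (τ - t)) (sq_nonneg (t + τ))]
  refine ⟨?_, hE0, by linarith⟩
  nlinarith [mul_nonneg hE0 (sub_nonneg.2 hE1)]

noncomputable def DD (β J Φ : ℝ → ℝ) (t τ E : ℝ) : ℝ :=
  Φ τ - Φ t - J t * (PP τ - PP t) + (1 - t^2) * β t * ((1 + 2*τ^2) * E - 2*(τ - t)^2)

lemma DD0 (t τ E : ℝ) : DD be0 J0 Ph0 t τ E = scD (√2 * t) (√2 * τ) E := by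
  have h' := s2pos
  unfold DD scD Ph0 bb be0
  rw [PP_pp, PP_pp]
  simp only [J0, mul_pow, sq2]
  rw [show (√2 * τ - √2 * t)^2 = 2 * (τ - t)^2 by rw [← mul_sub, mul_pow, sq2]]
  field_simp
  simp only [sq2]
  ring

lemma DD0_ge {t τ E c : ℝ} (ht : t^2 ≤ 1) (hτ : τ^2 ≤ 1) (h : (1 - E - t*τ)^2 ≤ (1 - t^2)*(1-τ^2))
    (hc : c = 0 ∨ (c = 1/50 ∧ t ^ 2 ≤ 1/5)) : c * E ≤ DD be0 J0 Ph0 t τ E := by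
  obtain ⟨h1, h2, -⟩ := constr ht hτ h
  rw [DD0]
  apply scD_ge
  · rw [mul_pow, sq2]; linarith
  · rw [mul_pow, sq2]; linarith
  · exact h2
  · rw [← mul_sub, ← mul_add, mul_pow, mul_pow, sq2]; nlinarith
  · rw [mul_pow, sq2]
    rcases hc with h | ⟨h, h'⟩
    · exact Or.inl h
    · exact Or.inr ⟨h, by linarith⟩

theorem scalarMain {δ : ℝ} (hδ : 0 < δ) : ∃ β J Φ : ℝ → ℝ, ContDiff ℝ (⊤ : ℕ∞) β ∧ ContDiff ℝ (⊤ : ℕ∞) J ∧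
    ContDiff ℝ (⊤ : ℕ∞) Φ ∧ (∀ t, HasDerivAt J (2 * β t) t) ∧
    ∀ t τ E c : ℝ, t^2 ≤ 1 → τ^2 ≤ 1 → (1 - E - t*τ)^2 ≤ (1 - t^2)*(1-τ^2) →
      (c = 0 ∨ (c = 1/50 ∧ t ^ 2 ≤ 1/5)) → (c - δ) * E ≤ DD β J Φ t τ E := by
  obtain ⟨ε, hε⟩ : ∃ ε, ε = δ / 16 := ⟨_, rfl⟩
  have hε0 : 0 < ε := by rw [hε]; positivity
  have hb0c : Continuous be0 := by unfold be0; fun_prop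
  obtain ⟨p, hp⟩ := exists_polynomial_near_of_continuousOn (-1) 1 be0 hb0c.continuousOn ε hε0
  have hβ : ContDiff ℝ (⊤ : ℕ∞) (fun t => p.eval t) := by
    simpa using p.contDiff_aeval (𝕜 := ℝ) (⊤ : ℕ∞)
  obtain ⟨J, hJs, hJ⟩ := antideriv (contDiff_const.mul hβ : ContDiff ℝ (⊤ : ℕ∞) fun t => 2 * p.eval t)
  have hs : ContDiff ℝ (⊤ : ℕ∞) (fun t => (3 - 6*t^2) * J t) := by
    refine ContDiff.mul ?_ hJs
    fun_prop
  obtain ⟨Φ, hΦs, hΦ⟩ := antideriv hs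
  refine ⟨fun t => p.eval t, J, Φ, hβ, hJs, hΦs, hJ, ?_⟩
  intro t τ E c ht hτ hcs hc
  have D0 := DD0_ge ht hτ hcs hc
  obtain ⟨-, hE0, hE2⟩ := constr ht hτ hcs
  have htI : t ∈ Icc (-1:ℝ) 1 := ⟨by nlinarith, by nlinarith⟩
  have hτI : τ ∈ Icc (-1:ℝ) 1 := ⟨by nlinarith, by nlinarith⟩
  have dJ : ∀ r ∈ Icc (-1:ℝ) 1, |(J r - J0 r) - (J t - J0 t)| ≤ 2 * ε * |r - t| := by
    intro r hr
    have := Convex.norm_image_sub_le_of_norm_hasDerivWithin_le (f := fun r => J r - J0 r) (C := 2 * ε)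
      (s := Icc (-1:ℝ) 1) (fun x _ => ((hJ x).sub (hasDerivAt_J0 x)).hasDerivWithinAt) (fun x hx => ?_)
      (convex_Icc _ _) htI hr
    · simpa using this
    · rw [← mul_sub, norm_mul]
      have := (hp x hx).le
      simp only [Real.norm_eq_abs, abs_two]
      linarith
  have dF : |(Φ τ - Ph0 τ - (J t - J0 t) * PP τ) - (Φ t - Ph0 t - (J t - J0 t) * PP t)| ≤ 6 * ε * |τ - t| * |τ - t| := by
    have hsub : uIcc t τ ⊆ Icc (-1:ℝ) 1 := uIcc_subset_Icc htI hτI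
    have := Convex.norm_image_sub_le_of_norm_hasDerivWithin_le 
      (f := fun r => Φ r - Ph0 r - (J t - J0 t) * PP r) (C := 6 * ε * |τ - t|)
      (s := uIcc t τ) (fun x _ => (((hΦ x).sub (hasDerivAt_Ph0 x)).sub
        ((hasDerivAt_PP x).const_mul (J t - J0 t))).hasDerivWithinAt) (fun x hx => ?_)
      (convex_uIcc _ _) left_mem_uIcc right_mem_uIcc
    · simpa using this
    · have e : (3 - 6*x^2) * J x - (3 - 6*x^2) * J0 x - (J t - J0 t) * (3 - 6*x^2)
        = (3 - 6*x^2) * ((J x - J0 x) - (J t - J0 t)) := by ring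
      rw [e, norm_mul, Real.norm_eq_abs, Real.norm_eq_abs]
      have hx' := hsub hx
      have h3 : |3 - 6*x^2| ≤ 3 := by
        rw [abs_le]; constructor <;> nlinarith [hx'.1, hx'.2, mul_nonneg (sub_nonneg.2 hx'.1) (sub_nonneg.2 hx'.2)]
      have h4 : |x - t| ≤ |τ - t| := abs_sub_left_of_mem_uIcc hx
      calc _ ≤ 3 * (2 * ε * |τ - t|) := by
            gcongr
            exact (dJ x hx').trans (by gcongr)
        _ = _ := by ring
  have dB : |(1 - t^2) * (p.eval t - be0 t) * ((1 + 2*τ^2) * E - 2*(τ - t)^2)| ≤ 1 * ε * (4 * E) := by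
    rw [abs_mul, abs_mul]
    have h1 : |1 - t^2| ≤ 1 := by rw [abs_le]; constructor <;> nlinarith [sq_nonneg t]
    have h2 := (hp t htI).le
    have h3 : |(1 + 2*τ^2) * E - 2*(τ - t)^2| ≤ 4 * E := by
      rw [abs_le]; constructor <;> nlinarith [sq_nonneg t, sq_nonneg (τ - t), mul_nonneg hE0 (sub_nonneg.2 hτ), mul_nonneg hE0 (sq_nonneg τ)]
    gcongr
  rw [mul_assoc, abs_mul_abs_self] at dF
  have dF' := (abs_le.1 dF).1
  have dB' := (abs_le.1 dB).1
  have : 6 * ε * ((τ - t) * (τ - t)) ≤ 12 * ε * E := by nlinarith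
  unfold DD at D0 ⊢
  have hδε : δ = 16 * ε := by rw [hε]; ring
  rw [hδε]
  nlinarith
end

section
open Real Set Metric MeasureTheory
open scoped RealInnerProductSpace Topology

abbrev V3 := EuclideanSpace ℝ (Fin 3)
abbrev E6 := EuclideanSpace ℝ (Fin 2 × Fin 3)

noncomputable def ee (i : Fin 3) : V3 := EuclideanSpace.single i 1

noncomputable def NN (i : Fin 3) (x : V3) : ℝ := √(‖x‖^2 - 3/4 * (x i)^2)
noncomputable def TT (i : Fin 3) (x : V3) : ℝ := x i / (2 * NN i x)
/-- `√2` times the gradient -/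
noncomputable def gg (i : Fin 3) (x : V3) : V3 :=
  ((1 + 2 * TT i x ^ 2) / NN i x) • x - (7/2 * TT i x + 3 * TT i x ^ 3) • ee i
noncomputable def rr (β J : ℝ → ℝ) (i : Fin 3) (x : V3) : V3 :=
  ((1 - TT i x ^ 2) * β (TT i x) / NN i x) • x - (2 * J (TT i x)) • ee i

noncomputable def mkE (a b : V3) : E6 :=
  WithLp.toLp 2 (fun p => if p.1 = 0 then a p.2 else b p.2)

lemma inner_mkE (a b c d : V3) : ⟪mkE a b, mkE c d⟫ = ⟪a, c⟫ + ⟪b, d⟫ := by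
  simp [mkE, PiLp.inner_apply, Fintype.sum_prod_type, Fin.sum_univ_two]

lemma mkE_sub (a b c d : V3) : mkE a b - mkE c d = mkE (a - c) (b - d) := by
  ext p
  simp only [mkE, PiLp.sub_apply]
  split_ifs <;> rfl

lemma contDiffOn_mkE {a b : V3 → V3} {s : Set V3} (ha : ContDiffOn ℝ (⊤:ℕ∞) a s)
    (hb : ContDiffOn ℝ (⊤:ℕ∞) b s) : ContDiffOn ℝ (⊤:ℕ∞) (fun x => mkE (a x) (b x)) s := by
  rw [contDiffOn_euclidean] at *
  rintro ⟨i, j⟩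
  by_cases h : i = 0
  · simpa [mkE, h] using ha j
  · simpa [mkE, h] using hb j

lemma coord_sq_le (i : Fin 3) (x : V3) : (x i)^2 ≤ ‖x‖^2 := by
  have := PiLp.norm_apply_le x i
  rw [Real.norm_eq_abs] at this
  rw [← sq_abs]; gcongr

lemma NN_sq (i : Fin 3) (x : V3) : NN i x ^ 2 = ‖x‖^2 - 3/4 * (x i)^2 :=
  Real.sq_sqrt (by nlinarith [coord_sq_le i x, sq_nonneg ‖x‖])

lemma NN_arg_pos (i : Fin 3) {x : V3} (hx : x ≠ 0) : 0 < ‖x‖^2 - 3/4 * (x i)^2 := by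
  have := norm_pos_iff.2 hx
  nlinarith [coord_sq_le i x]

lemma NN_pos (i : Fin 3) {x : V3} (hx : x ≠ 0) : 0 < NN i x := Real.sqrt_pos.2 (NN_arg_pos i hx)

lemma two_TT_NN (i : Fin 3) {x : V3} (hx : x ≠ 0) : x i = 2 * TT i x * NN i x := by
  have := NN_pos i hx
  unfold TT; field_simp

lemma norm_sq_NN (i : Fin 3) {x : V3} (hx : x ≠ 0) : ‖x‖^2 = (1 + 3 * TT i x ^ 2) * NN i x ^ 2 := by
  have h1 := NN_sq i x
  rw [two_TT_NN i hx] at h1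
  linarith

lemma TT_sq_le (i : Fin 3) {x : V3} (hx : x ≠ 0) : TT i x ^ 2 ≤ 1 := by
  have h1 := norm_sq_NN i hx
  have h2 := coord_sq_le i x
  rw [two_TT_NN i hx] at h2
  have := pow_pos (NN_pos i hx) 2
  by_contra h
  push Not at h
  nlinarith

lemma contDiffOn_coord (i : Fin 3) (s : Set V3) : ContDiffOn ℝ (⊤:ℕ∞) (fun x : V3 => x i) s :=
  (contDiff_euclidean.1 contDiff_id i).contDiffOn

lemma contDiffOn_NN (i : Fin 3) : ContDiffOn ℝ (⊤:ℕ∞) (NN i) {0}ᶜ := by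
  unfold NN
  refine ContDiffOn.sqrt ?_ (fun x hx => (NN_arg_pos i hx).ne')
  exact (contDiff_norm_sq ℝ).contDiffOn.sub (contDiffOn_const.mul ((contDiffOn_coord i _).pow 2))

lemma contDiffOn_TT (i : Fin 3) : ContDiffOn ℝ (⊤:ℕ∞) (TT i) {0}ᶜ := by
  unfold TT
  refine ContDiffOn.div (contDiffOn_coord i _) (contDiffOn_const.mul (contDiffOn_NN i)) (fun x hx => ?_)
  have := NN_pos i hx
  positivity

lemma contDiffOn_gg (i : Fin 3) : ContDiffOn ℝ (⊤:ℕ∞) (gg i) {0}ᶜ := by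
  have hT := contDiffOn_TT i
  unfold gg
  refine ContDiffOn.sub (ContDiffOn.smul (ContDiffOn.div ?_ (contDiffOn_NN i) (fun x hx => (NN_pos i hx).ne'))
    contDiffOn_id) (ContDiffOn.fun_smul ?_ contDiffOn_const)
  · exact contDiffOn_const.add (contDiffOn_const.mul (hT.pow 2))
  · exact (contDiffOn_const.mul hT).add (contDiffOn_const.mul (hT.pow 3))

lemma contDiffOn_rr {β J : ℝ → ℝ} (hβ : ContDiff ℝ (⊤:ℕ∞) β) (hJ : ContDiff ℝ (⊤:ℕ∞) J) (i : Fin 3) :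
    ContDiffOn ℝ (⊤:ℕ∞) (rr β J i) {0}ᶜ := by
  have hT := contDiffOn_TT i
  unfold rr
  refine ContDiffOn.sub (ContDiffOn.smul (ContDiffOn.div ?_ (contDiffOn_NN i) (fun x hx => (NN_pos i hx).ne'))
    contDiffOn_id) (ContDiffOn.fun_smul ?_ contDiffOn_const)
  · exact (contDiffOn_const.sub (hT.pow 2)).mul (hβ.comp_contDiffOn hT)
  · exact contDiffOn_const.mul (hJ.comp_contDiffOn hT)

/-- the normalized bilinear form -/
noncomputable def ZZ (i : Fin 3) (x y : V3) : ℝ := (⟪x, y⟫ - 3/4 * (x i * y i)) / (NN i x * NN i y)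

lemma inner_ZZ (i : Fin 3) {x y : V3} (hx : x ≠ 0) (hy : y ≠ 0) :
    ⟪x, y⟫ = (ZZ i x y + 3 * TT i x * TT i y) * (NN i x * NN i y) := by
  have h1 := NN_pos i hx
  have h2 := NN_pos i hy
  unfold ZZ TT
  field_simp
  ring

lemma inner_ee_right (i : Fin 3) (x : V3) : ⟪x, ee i⟫ = x i := by
  simp [ee, EuclideanSpace.inner_single_right]
lemma inner_ee_left (i : Fin 3) (x : V3) : ⟪ee i, x⟫ = x i := by
  simp [ee, EuclideanSpace.inner_single_left]
lemma ee_self (i : Fin 3) : ee i i = 1 := by simp [ee]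

lemma inner_x_gg (i : Fin 3) {x y : V3} (hx : x ≠ 0) (hy : y ≠ 0) :
    ⟪x, gg i y⟫ = NN i x * ((1 + 2 * TT i y ^ 2) * ZZ i x y - 4 * TT i x * TT i y) := by
  have h2 := NN_pos i hy
  rw [gg, inner_sub_right, inner_smul_right, inner_smul_right, inner_ee_right, inner_ZZ i hx hy,
    two_TT_NN i hx]
  field_simp
  ring

lemma ee_gg (i : Fin 3) {y : V3} (hy : y ≠ 0) : gg i y i = - PP (TT i y) / 2 := by
  have h2 := NN_pos i hy
  have h3 := two_TT_NN i hy
  simp only [gg, PiLp.sub_apply, PiLp.smul_apply, ee_self, smul_eq_mul, PP]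
  rw [h3]
  field_simp
  ring

lemma ZZ_self (i : Fin 3) {x : V3} (hx : x ≠ 0) : ZZ i x x = 1 := by
  have h1 := NN_pos i hx
  have := inner_ZZ i hx hx
  rw [real_inner_self_eq_norm_sq, norm_sq_NN i hx] at this
  have h2 := pow_pos h1 2
  have : (ZZ i x x - 1) * NN i x ^ 2 = 0 := by linarith
  rcases mul_eq_zero.1 this with h | h
  · linarith
  · exact absurd h h2.ne'

lemma rr_gg (β J : ℝ → ℝ) (i : Fin 3) {x y : V3} (hx : x ≠ 0) (hy : y ≠ 0) :
    ⟪rr β J i x, gg i y⟫ = (1 - TT i x ^ 2) * β (TT i x) * ((1 + 2 * TT i y ^ 2) * ZZ i x y - 4 * TT i x * TT i y)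
      + J (TT i x) * PP (TT i y) := by
  have h1 := NN_pos i hx
  rw [rr, inner_sub_left, real_inner_smul_left, real_inner_smul_left, inner_ee_left, ee_gg i hy, inner_x_gg i hx hy]
  field_simp
  ring

lemma DD_eq (β J Φ : ℝ → ℝ) (i : Fin 3) {x y : V3} (hx : x ≠ 0) (hy : y ≠ 0) :
    Φ (TT i y) - Φ (TT i x) - ⟪rr β J i x, gg i y - gg i x⟫ = DD β J Φ (TT i x) (TT i y) (1 - ZZ i x y) := by
  rw [inner_sub_right, rr_gg β J i hx hy, rr_gg β J i hx hx, ZZ_self i hx, DD]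
  ring

/-- Cauchy-Schwarz -/
lemma ZZ_constr (i : Fin 3) {x y : V3} (hx : x ≠ 0) (hy : y ≠ 0) :
    (1 - (1 - ZZ i x y) - TT i x * TT i y)^2 ≤ (1 - TT i x ^ 2) * (1 - TT i y ^ 2) := by
  have h1 := NN_pos i hx
  have h2 := NN_pos i hy
  have hCS := real_inner_mul_inner_self_le (x - x i • ee i) (y - y i • ee i)
  have e : ∀ a b : V3, ⟪a - a i • ee i, b - b i • ee i⟫ = ⟪a, b⟫ - a i * b i := by
    intro a b
    simp only [inner_sub_left, inner_sub_right, real_inner_smul_left, inner_smul_right, inner_ee_left,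
      inner_ee_right, ee_self]
    ring
  rw [e, e, e, inner_ZZ i hx hy, inner_ZZ i hx hx, inner_ZZ i hy hy, ZZ_self i hx, ZZ_self i hy,
    two_TT_NN i hx, two_TT_NN i hy] at hCS
  have h3 : 0 < (NN i x * NN i y)^2 := by positivity
  rw [← sub_nonneg]
  refine nonneg_of_mul_nonneg_left ?_ h3
  nlinarith

lemma NN_le (i : Fin 3) {x : V3} (hx : ‖x‖ = 1) : NN i x ≤ 1 ∧ 1/4 ≤ NN i x ^ 2 ∧ NN i x ^ 2 ≤ 1 := by
  have h1 := NN_sq i x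
  have h2 := coord_sq_le i x
  rw [hx] at h1 h2
  have h3 : 0 ≤ NN i x := Real.sqrt_nonneg _
  exact ⟨by nlinarith [sq_nonneg (x i)], by nlinarith, by nlinarith [sq_nonneg (x i)]⟩
end

section
open Real Set Metric MeasureTheory
open scoped RealInnerProductSpace Topology

lemma ZZ_upper (i : Fin 3) {x y : V3} (hx : ‖x‖ = 1) (hy : ‖y‖ = 1) :
    1 - ZZ i x y ≤ 2 * ‖y - x‖^2 ∧ ‖y - x‖^2 ≤ 8 * (1 - ZZ i x y) := by
  have hx0 : x ≠ 0 := by rintro rfl; simp at hx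
  have hy0 : y ≠ 0 := by rintro rfl; simp at hy
  have p1 := NN_pos i hx0
  have p2 := NN_pos i hy0
  obtain ⟨a1, a2, a3⟩ := NN_le i hx
  obtain ⟨b1, b2, b3⟩ := NN_le i hy
  have s1 := NN_sq i x
  have s2 := NN_sq i y
  rw [hx] at s1
  rw [hy] at s2
  have hZ : ZZ i x y * (NN i x * NN i y) = ⟪x, y⟫ - 3/4 * (x i * y i) := by
    unfold ZZ; field_simp
  have n1 : ‖y - x‖^2 = 2 - 2 * ⟪x, y⟫ := by
    rw [norm_sub_sq_real, hx, hy, real_inner_comm]; ring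
  have h4 : 1/4 ≤ NN i x * NN i y := by
    have e1 : 1/2 ≤ NN i x := by nlinarith
    have e2 : 1/2 ≤ NN i y := by nlinarith
    nlinarith
  constructor
  · have h5 : 2 * (NN i x * NN i y) * (1 - ZZ i x y) ≤ ‖y - x‖^2 := by
      nlinarith [sq_nonneg (NN i x - NN i y), sq_nonneg (x i - y i)]
    rcases le_total (1 - ZZ i x y) 0 with h | h
    · nlinarith [sq_nonneg ‖y - x‖]
    · nlinarith
  · set v : V3 := NN i y • x - NN i x • y with hv
    have v1 : ‖v‖^2 = NN i y ^ 2 + NN i x ^ 2 - 2 * (NN i x * NN i y) * ⟪x, y⟫ := by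
      rw [hv, norm_sub_sq_real, norm_smul, norm_smul, hx, hy, real_inner_smul_left, inner_smul_right]
      simp only [Real.norm_eq_abs, mul_one, sq_abs]; ring
    have v2 : v i = NN i y * x i - NN i x * y i := by
      simp [hv]
    have v3 := coord_sq_le i v
    have q : ‖v‖^2 - 3/4 * (v i)^2 = 2 * (NN i x * NN i y)^2 * (1 - ZZ i x y) := by
      rw [v1, v2]
      linear_combination (-NN i y ^2) * s1 - NN i x ^2 * s2 + 2 * (NN i x * NN i y) * hZ
    have h5 : NN i x * NN i y * ‖y - x‖^2 ≤ 8 * (NN i x * NN i y)^2 * (1 - ZZ i x y) := by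
      nlinarith [sq_nonneg (NN i x - NN i y)]
    have h6 : 0 < NN i x * NN i y := by positivity
    have h7 : ‖y - x‖^2 ≤ 8 * (NN i x * NN i y) * (1 - ZZ i x y) := by
      refine le_of_mul_le_mul_left ?_ h6
      nlinarith
    have h8 : NN i x * NN i y ≤ 1 := by nlinarith
    have h9 : 0 ≤ 1 - ZZ i x y := by
      by_contra h
      push Not at h
      nlinarith [mul_neg_of_pos_of_neg h6 h, sq_nonneg ‖y - x‖]
    have h10 := mul_le_of_le_one_left h9 h8
    linarith

lemma TT_small (i : Fin 3) {x : V3} (hx : ‖x‖ = 1) (h : (x i)^2 ≤ 1/2) : TT i x ^2 ≤ 1/5 := by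
  have hx0 : x ≠ 0 := by rintro rfl; simp at hx
  have p1 := pow_pos (NN_pos i hx0) 2
  have s1 := norm_sq_NN i hx0
  rw [hx] at s1
  rw [two_TT_NN i hx0] at h
  by_contra hc
  push Not at hc
  nlinarith

lemma small_or {x : V3} (hx : ‖x‖ = 1) : (x 0)^2 ≤ 1/2 ∨ (x 2)^2 ≤ 1/2 := by
  have := EuclideanSpace.norm_sq_eq x
  simp only [Fin.sum_univ_three, Real.norm_eq_abs, sq_abs, hx] at this
  by_contra h
  push Not at h
  nlinarith [h.1, h.2, sq_nonneg (x 1)]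

noncomputable def YY (x : V3) : E6 := mkE ((√2)⁻¹ • gg 0 x) ((√2)⁻¹ • gg 2 x)
noncomputable def AA (β J : ℝ → ℝ) (x : V3) : E6 := mkE (√2 • rr β J 0 x) (√2 • rr β J 2 x)
noncomputable def ff (Φ : ℝ → ℝ) (x : V3) : ℝ := Φ (TT 0 x) + Φ (TT 2 x)

lemma D_eq (β J Φ : ℝ → ℝ) {x y : V3} (hx : x ≠ 0) (hy : y ≠ 0) :
    ff Φ y - ff Φ x - ⟪AA β J x, YY y - YY x⟫ = DD β J Φ (TT 0 x) (TT 0 y) (1 - ZZ 0 x y)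
      + DD β J Φ (TT 2 x) (TT 2 y) (1 - ZZ 2 x y) := by
  rw [← DD_eq β J Φ 0 hx hy, ← DD_eq β J Φ 2 hx hy, YY, YY, AA, mkE_sub, inner_mkE, ← smul_sub, ← smul_sub]
  simp only [real_inner_smul_left, inner_smul_right, ff]
  have := s2pos
  field_simp
  ring

theorem mainD : ∃ β J Φ : ℝ → ℝ, ContDiff ℝ (⊤ : ℕ∞) β ∧ ContDiff ℝ (⊤ : ℕ∞) J ∧
    ContDiff ℝ (⊤ : ℕ∞) Φ ∧ (∀ t, HasDerivAt J (2 * β t) t) ∧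
    ∀ x ∈ sphere (0:V3) 1, ∀ y ∈ sphere (0:V3) 1,
      (1/1000) * ‖y - x‖^2 ≤ ff Φ y - ff Φ x - ⟪AA β J x, YY y - YY x⟫ := by
  obtain ⟨β, J, Φ, hβ, hJ, hΦ, hd, H⟩ := scalarMain (δ := 1/10000) (by norm_num)
  refine ⟨β, J, Φ, hβ, hJ, hΦ, hd, fun x hx y hy => ?_⟩
  rw [mem_sphere_zero_iff_norm] at hx hy
  have hx0 : x ≠ 0 := by rintro rfl; simp at hx
  have hy0 : y ≠ 0 := by rintro rfl; simp at hy
  rw [D_eq β J Φ hx0 hy0]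
  have G := fun i c => H (TT i x) (TT i y) (1 - ZZ i x y) c (TT_sq_le i hx0) (TT_sq_le i hy0) (ZZ_constr i hx0 hy0)
  obtain ⟨u0, l0⟩ := ZZ_upper 0 hx hy
  obtain ⟨u2, l2⟩ := ZZ_upper 2 hx hy
  have g0 := G 0 0 (Or.inl rfl)
  have g2 := G 2 0 (Or.inl rfl)
  have := sq_nonneg ‖y - x‖
  rcases small_or hx with h | h
  · have k := G 0 (1/50) (Or.inr ⟨rfl, TT_small 0 hx h⟩)
    linarith
  · have k := G 2 (1/50) (Or.inr ⟨rfl, TT_small 2 hx h⟩)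
    linarith

/-- Cut-off lemma -/
lemma cut {W : Type*} [NormedAddCommGroup W] [NormedSpace ℝ W] {g : V3 → W}
    (hg : ContDiffOn ℝ (⊤:ℕ∞) g {0}ᶜ) :
    ∃ g' : V3 → W, ContDiff ℝ (⊤:ℕ∞) g' ∧ ∀ x, 1/2 ≤ ‖x‖ → g' x = g x := by
  let φ : ContDiffBump (0:V3) := ⟨1/4, 1/2, by norm_num, by norm_num⟩
  refine ⟨fun x => (1 - φ x) • g x, ?_, ?_⟩
  · rw [contDiff_iff_contDiffAt]
    intro x
    by_cases hx : x = 0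
    · subst hx
      refine (contDiffAt_const (c := (0:W))).congr_of_eventuallyEq ?_
      filter_upwards [φ.eventuallyEq_one] with y hy
      rw [hy]; simp
    · exact (contDiffAt_const.sub φ.contDiffAt).fun_smul
        ((hg x hx).contDiffAt (isOpen_compl_singleton.mem_nhds hx))
  · intro x hx
    have : φ x = 0 := φ.zero_of_le_dist (by rw [dist_zero_right]; exact hx)
    simp [this]
end

section
open Real Set Metric MeasureTheory
open scoped RealInnerProductSpace Topology Manifold ContDiff

noncomputable def iT (i : Fin 3) (g : V3) : ℝ := √2 * sin (arcsin (-2 * g i / √2) / 3)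
noncomputable def im (i : Fin 3) (g : V3) : V3 :=
  (1 + 2 * iT i g ^2)⁻¹ • g + (2 * iT i g - (1 + 2 * iT i g ^2)⁻¹ * g i) • ee i
def iU (i : Fin 3) : Set V3 := {g | 5 * (g i)^2 < ‖g‖^2 ∧ (g i)^2 < 1/2}

lemma isOpen_iU (i : Fin 3) : IsOpen (iU i) := by
  have hc : Continuous fun g : V3 => g i := (contDiff_euclidean (n := 0).1 contDiff_id i).continuous
  have h1 : IsOpen {g : V3 | 5 * (g i)^2 < ‖g‖^2} := isOpen_lt (by fun_prop) (by fun_prop)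
  have h2 : IsOpen {g : V3 | (g i)^2 < 1/2} := isOpen_lt (by fun_prop) (by fun_prop)
  exact h1.inter h2

lemma contDiffOn_iT (i : Fin 3) : ContDiffOn ℝ (⊤:ℕ∞) (iT i) (iU i) := by
  unfold iT
  refine contDiffOn_const.mul (contDiff_sin.comp_contDiffOn (ContDiffOn.div_const ?_ _))
  intro g hg
  have h2 : (-2 * g i / √2)^2 < 1 := by
    rw [div_pow, sq2]; nlinarith [hg.2]
  refine ContDiffAt.comp_contDiffWithinAt (g := arcsin) (f := fun g : V3 => -2 * g i / √2) g (contDiffAt_arcsin ?_ ?_)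
    (((contDiffOn_const.mul (contDiffOn_coord i (iU i))).div_const _) g hg)
  · intro h; rw [h] at h2; norm_num at h2
  · intro h; rw [h] at h2; norm_num at h2

lemma contDiffOn_im (i : Fin 3) : ContDiffOn ℝ (⊤:ℕ∞) (im i) (iU i) := by
  have hT := contDiffOn_iT i
  have hI : ContDiffOn ℝ (⊤:ℕ∞) (fun g => (1 + 2 * iT i g ^2)⁻¹) (iU i) := by
    refine ContDiffOn.inv (contDiffOn_const.add (contDiffOn_const.mul (hT.pow 2))) (fun x _ => by positivity)
  unfold im
  exact (hI.fun_smul contDiffOn_id).add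
    (((contDiffOn_const.mul hT).sub (hI.mul (contDiffOn_coord i _))).fun_smul contDiffOn_const)

lemma im_ne (i : Fin 3) {g : V3} (hg : g ∈ iU i) : im i g ≠ 0 := by
  intro h
  have h0 : (1 + 2 * iT i g ^2) ≠ 0 := by positivity
  have : g = (-((1 + 2 * iT i g ^2) * (2 * iT i g - (1 + 2 * iT i g ^2)⁻¹ * g i))) • ee i := by
    have h1 := congrArg (fun v => (1 + 2 * iT i g ^2) • v) h
    simp only [im, smul_add, smul_smul, mul_inv_cancel₀ h0, one_smul, smul_zero] at h1
    rw [neg_smul, eq_neg_iff_add_eq_zero]; exact h1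
  generalize (-((1 + 2 * iT i g ^2) * (2 * iT i g - (1 + 2 * iT i g ^2)⁻¹ * g i))) = c at this
  have h1 := hg.1
  rw [this, norm_smul, PiLp.smul_apply, ee_self] at h1
  have : ‖ee i‖ = 1 := by simp [ee]
  rw [this] at h1
  simp only [Real.norm_eq_abs, mul_one, sq_abs, smul_eq_mul] at h1
  nlinarith [sq_nonneg c]

noncomputable def iX (i : Fin 3) (g : V3) : V3 := ‖im i g‖⁻¹ • im i g

lemma contDiffOn_iX (i : Fin 3) : ContDiffOn ℝ (⊤:ℕ∞) (iX i) (iU i) := by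
  have h := contDiffOn_im i
  unfold iX
  exact ((h.norm ℝ (fun x hx => im_ne i hx)).inv (fun x hx => norm_ne_zero_iff.2 (im_ne i hx))).fun_smul h

lemma gg_norm (i : Fin 3) {x : V3} (hx : x ≠ 0) :
    ‖gg i x‖^2 - 5 * (gg i x i)^2 = (1 - 2 * TT i x ^2)^3 := by
  have h1 := NN_pos i hx
  have : ‖gg i x‖^2 = ⟪gg i x, gg i x⟫ := (real_inner_self_eq_norm_sq _).symm
  rw [this]
  nth_rewrite 1 [gg]
  rw [inner_sub_left, real_inner_smul_left, real_inner_smul_left, inner_x_gg i hx hx, inner_ee_left,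
    ZZ_self i hx, ee_gg i hx, PP]
  field_simp
  ring

lemma gg_i_sq (i : Fin 3) {x : V3} (hx : x ≠ 0) :
    4 * (gg i x i)^2 = 2 - (1 - 2 * TT i x ^2)^2 * (2 - TT i x ^2) := by
  rw [ee_gg i hx, PP]; ring

lemma gg_mem_iU (i : Fin 3) {x : V3} (hx : x ≠ 0) : gg i x ∈ iU i ↔ TT i x ^ 2 < 1/2 := by
  have h1 := gg_norm i hx
  have h2 := gg_i_sq i hx
  constructor
  · intro h
    have h3 : 0 < (1 - 2 * TT i x ^2)^3 := by have := h.1; linarith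
    have := (Odd.pow_pos_iff (by decide : Odd 3)).1 h3
    linarith
  · intro h
    have h3 : 0 < 1 - 2 * TT i x ^2 := by linarith
    refine ⟨?_, ?_⟩
    · have := pow_pos h3 3; linarith
    · have : 0 < (1 - 2 * TT i x ^2)^2 * (2 - TT i x ^2) := by
        apply mul_pos (pow_pos h3 2); linarith
      linarith

lemma iT_gg (i : Fin 3) {x : V3} (hx : x ≠ 0) (h : TT i x ^ 2 < 1/2) : iT i (gg i x) = TT i x := by
  set t := TT i x with ht
  have h2 := s2pos
  have hs : (t / √2)^2 < (1/2)^2 := by rw [div_pow, sq2]; linarith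
  have hs' := abs_lt_of_sq_lt_sq hs (by norm_num)
  rw [abs_lt] at hs'
  set φ := arcsin (t / √2) with hφ
  have hsin : sin φ = t / √2 := sin_arcsin (by linarith) (by linarith)
  have hφ1 : φ ≤ π / 6 := by
    rw [hφ]
    refine (arcsin_le_iff_le_sin' ⟨?_, ?_⟩).2 (by rw [sin_pi_div_six]; linarith) <;> linarith [pi_pos]
  have hφ2 : -(π / 6) ≤ φ := by
    rw [hφ]
    refine (le_arcsin_iff_sin_le' ⟨?_, ?_⟩).2 (by rw [sin_neg, sin_pi_div_six]; linarith) <;> linarith [pi_pos]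
  have e : -2 * gg i x i / √2 = sin (3 * φ) := by
    rw [sin_three_mul, hsin, ee_gg i hx, PP, ← ht]
    field_simp
    rw [sq2]; ring
  rw [iT, e, arcsin_sin (by linarith) (by linarith)]
  rw [mul_div_cancel_left₀ _ (by norm_num : (3:ℝ) ≠ 0), hsin]
  field_simp

lemma iX_gg (i : Fin 3) {x : V3} (hx : ‖x‖ = 1) (h : TT i x ^ 2 < 1/2) : iX i (gg i x) = x := by
  have hx0 : x ≠ 0 := by rintro rfl; simp at hx
  have hN := NN_pos i hx0
  have hm : im i (gg i x) = (NN i x)⁻¹ • x := by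
    rw [im, iT_gg i hx0 h, ee_gg i hx0, gg, smul_sub, smul_smul, smul_smul]
    have h0 : (1 + 2 * TT i x ^2) ≠ 0 := by positivity
    rw [sub_add, ← sub_smul]
    have e1 : (1 + 2 * TT i x ^ 2)⁻¹ * ((1 + 2 * TT i x ^ 2) / NN i x) = (NN i x)⁻¹ := by field_simp
    have e2 : (1 + 2 * TT i x ^ 2)⁻¹ * (7 / 2 * TT i x + 3 * TT i x ^ 3) -
      (2 * TT i x - (1 + 2 * TT i x ^ 2)⁻¹ * (-PP (TT i x) / 2)) = 0 := by
      unfold PP; field_simp; ring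
    rw [e1, e2, zero_smul, sub_zero]
  rw [iX, hm, norm_smul, hx, mul_one, norm_inv, Real.norm_of_nonneg hN.le, inv_inv, smul_smul,
    mul_inv_cancel₀ hN.ne', one_smul]

noncomputable def row (k : Fin 2) (P : E6) : V3 := WithLp.toLp 2 (fun j => √2 * P (k, j))
lemma contDiff_row (k : Fin 2) : ContDiff ℝ (⊤:ℕ∞) (row k) := by
  rw [contDiff_euclidean]
  intro j
  exact contDiff_const.mul (contDiff_euclidean.1 contDiff_id (k, j))

lemma row_YY0 (x : V3) : row 0 (YY x) = gg 0 x := by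
  have := s2pos
  ext j
  simp [row, YY, mkE]
lemma row_YY1 (x : V3) : row 1 (YY x) = gg 2 x := by
  have := s2pos
  ext j
  simp [row, YY, mkE]

lemma contDiffOn_YY : ContDiffOn ℝ (⊤:ℕ∞) YY {0}ᶜ :=
  contDiffOn_mkE ((contDiffOn_gg 0).const_smul _) ((contDiffOn_gg 2).const_smul _)

lemma sphere_sub : sphere (0:V3) 1 ⊆ {0}ᶜ := by
  intro x hx h
  rw [mem_singleton_iff] at h
  subst h
  simp at hx

lemma X_loc (k : Fin 2) (i : Fin 3) (hrow : ∀ x, row k (YY x) = gg i x) {x : V3} (hx : ‖x‖ = 1)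
    (h : (x i)^2 ≤ 1/2) : ∃ U ∈ 𝓝 (YY x), ∃ g : E6 → V3, ContDiffOn ℝ (⊤:ℕ∞) g U ∧
      ∀ Q ∈ U, ∀ y ∈ sphere (0:V3) 1, YY y = Q → g Q = y := by
  have hx0 : x ≠ 0 := by rintro rfl; simp at hx
  refine ⟨row k ⁻¹' iU i, ((isOpen_iU i).preimage (contDiff_row k).continuous).mem_nhds ?_,
    fun Q => iX i (row k Q), (contDiffOn_iX i).comp (contDiff_row k).contDiffOn (fun _ hq => hq), ?_⟩
  · rw [mem_preimage, hrow, gg_mem_iU i hx0]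
    have := TT_small i hx h
    linarith
  · rintro Q hQ y hy rfl
    rw [mem_preimage, hrow, gg_mem_iU i (sphere_sub hy)] at hQ
    simp only [hrow]
    rw [iX_gg i (mem_sphere_zero_iff_norm.1 hy) hQ]

theorem exists_X : ∃ X : E6 → V3, ContDiff ℝ (⊤:ℕ∞) X ∧ (∀ x ∈ sphere (0:V3) 1, X (YY x) = x) ∧
    ∀ x ∈ sphere (0:V3) 1, ∀ᶠ P in 𝓝 (YY x), X P ∈ sphere (0:V3) 1 := by
  obtain ⟨X, hX⟩ := exists_contMDiffMap_forall_mem_convex_of_local (n := (⊤:ℕ∞)) 𝓘(ℝ, E6)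
    (t := fun Q : E6 => {v : V3 | ∀ y ∈ sphere (0:V3) 1, YY y = Q → v = y})
    (by
      intro Q v hv w hw a b ha hb hab y hy hyQ
      rw [hv y hy hyQ, hw y hy hyQ, ← add_smul, hab, one_smul])
    (by
      intro P
      by_cases hP : P ∈ Set.image YY (sphere (0:V3) 1)
      · obtain ⟨x, hx, rfl⟩ := hP
        rw [mem_sphere_zero_iff_norm] at hx
        have : ∃ U ∈ 𝓝 (YY x), ∃ g : E6 → V3, ContDiffOn ℝ (⊤:ℕ∞) g U ∧
            ∀ Q ∈ U, ∀ y ∈ sphere (0:V3) 1, YY y = Q → g Q = y := by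
          rcases small_or hx with h | h
          · exact X_loc 0 0 row_YY0 hx h
          · exact X_loc 1 2 row_YY1 hx h
        obtain ⟨U, hU, g, hg, H⟩ := this
        exact ⟨U, hU, g, contMDiffOn_iff_contDiffOn.2 hg, H⟩
      · have hcl : IsClosed (Set.image YY (sphere (0:V3) 1)) :=
          ((isCompact_sphere _ _).image_of_continuousOn (contDiffOn_YY.continuousOn.mono sphere_sub)).isClosed
        refine ⟨_, hcl.isOpen_compl.mem_nhds hP, fun _ => 0, contMDiffOn_const, ?_⟩
        intro Q hQ y hy hyQ
        exact absurd ⟨y, hy, hyQ⟩ hQ)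
  have hXs : ContDiff ℝ (⊤:ℕ∞) (X : E6 → V3) := X.contMDiff.contDiff
  have hn : ContDiffOn ℝ (⊤:ℕ∞) (fun v : V3 => ‖v‖⁻¹ • v) {0}ᶜ :=
    ((contDiffOn_id.norm ℝ (fun x hx => hx)).inv (fun x hx => by
      have hx' : x ≠ 0 := hx
      simpa using hx')).fun_smul contDiffOn_id
  obtain ⟨n, hns, hne⟩ := cut hn
  refine ⟨fun P => n (X P), hns.comp hXs, ?_, ?_⟩
  · intro x hx
    have h1 := mem_sphere_zero_iff_norm.1 hx
    have h2 : X (YY x) = x := hX (YY x) x hx rfl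
    simp only [h2]
    rw [hne x (by rw [h1]; norm_num), h1]; simp
  · intro x hx
    have h1 := mem_sphere_zero_iff_norm.1 hx
    have h2 : X (YY x) = x := hX (YY x) x hx rfl
    have : ∀ᶠ P in 𝓝 (YY x), 1/2 < ‖X P‖ := by
      apply (hXs.continuous.norm.continuousAt (x := YY x)).eventually_const_lt
      simp only [h2, h1]; norm_num
    filter_upwards [this] with P hP
    rw [hne _ hP.le, mem_sphere_zero_iff_norm, norm_smul, norm_inv, norm_norm, inv_mul_cancel₀]
    linarith
end

section
open Real Set Metric MeasureTheory
open scoped RealInnerProductSpace Topology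

theorem exists_F : ∃ β J : ℝ → ℝ, ContDiff ℝ (⊤ : ℕ∞) β ∧ ContDiff ℝ (⊤ : ℕ∞) J ∧
    (∀ t, HasDerivAt J (2 * β t) t) ∧ ∃ (F : E6 → ℝ) (γ Λ : ℝ), ContDiff ℝ (⊤:ℕ∞) F ∧ 0 < γ ∧ γ ≤ Λ ∧
    (∀ P Q, γ*‖Q-P‖^2 ≤ F Q - F P - fderiv ℝ F P (Q-P) ∧ F Q - F P - fderiv ℝ F P (Q-P) ≤ Λ*‖Q-P‖^2) ∧
    ∀ x ∈ sphere (0:V3) 1, fderiv ℝ F (YY x) = innerSL ℝ (AA β J x) := by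
  obtain ⟨β, J, Φ, hβ, hJ, hΦ, hd, H⟩ := mainD
  obtain ⟨X, hX, hXY, hXS⟩ := exists_X
  have hA : ContDiffOn ℝ (⊤:ℕ∞) (AA β J) {0}ᶜ :=
    contDiffOn_mkE ((contDiffOn_rr hβ hJ 0).const_smul _) ((contDiffOn_rr hβ hJ 2).const_smul _)
  have hf : ContDiffOn ℝ (⊤:ℕ∞) (ff Φ) {0}ᶜ :=
    (hΦ.comp_contDiffOn (contDiffOn_TT 0)).add (hΦ.comp_contDiffOn (contDiffOn_TT 2))
  obtain ⟨A', hA', eA⟩ := cut hA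
  obtain ⟨Y', hY', eY⟩ := cut contDiffOn_YY
  obtain ⟨f', hf', ef⟩ := cut hf
  have hh : ∀ x ∈ sphere (0:V3) 1, 1/2 ≤ ‖x‖ := fun x hx => by
    rw [mem_sphere_zero_iff_norm.1 hx]; norm_num
  refine ⟨β, J, hβ, hJ, hd, ?_⟩
  obtain ⟨F, γ, Λ, h1, h2, h3, h4, h5⟩ := extMain (isCompact_sphere (0:V3) 1)
    (NormedSpace.sphere_nonempty.2 zero_le_one) hf' hA' hY' hX
    (fun x hx => by rw [eY x (hh x hx)]; exact hXY x hx)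
    (fun x hx => by rw [eY x (hh x hx)]; exact hXS x hx)
    (c := 1/1000) (by norm_num)
    (fun x hx y hy => by
      rw [eY x (hh x hx), eY y (hh y hy), eA x (hh x hx), ef x (hh x hx), ef y (hh y hy)]
      exact H x hx y hy)
  refine ⟨F, γ, Λ, h1, h2, h3, h4, fun x hx => ?_⟩
  rw [← eY x (hh x hx), ← eA x (hh x hx)]
  exact h5 x hx
end

section
open Real Set Metric MeasureTheory
open scoped RealInnerProductSpace Topology

lemma hdiv {f g : V3 → ℝ} {f' g' : V3 →L[ℝ] ℝ} {x : V3} (hf : HasFDerivAt f f' x) (hg : HasFDerivAt g g' x)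
    (h0 : g x ≠ 0) : HasFDerivAt (fun y => f y / g y) ((g x)⁻¹ • f' - (f x / (g x)^2) • g') x := by
  have h := hf.mul ((hasDerivAt_inv h0).comp_hasFDerivAt x hg)
  refine (h.congr_of_eventuallyEq (Filter.Eventually.of_forall fun y => ?_)).congr_fderiv ?_
  · simp [div_eq_mul_inv]
  · ext v
    simp
    field_simp
    ring

noncomputable def dN (i : Fin 3) (x : V3) : V3 →L[ℝ] ℝ :=
  (NN i x)⁻¹ • (innerSL ℝ x - (3/4 * x i) • innerSL ℝ (ee i))
noncomputable def dT (i : Fin 3) (x : V3) : V3 →L[ℝ] ℝ :=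
  (2 * NN i x)⁻¹ • innerSL ℝ (ee i) - (TT i x / NN i x) • dN i x

lemma dN_apply (i : Fin 3) (x v : V3) : dN i x v = (NN i x)⁻¹ * (⟪x, v⟫ - 3/4 * x i * v i) := by
  simp only [dN, smul_apply, sub_apply, innerSL_apply_apply, inner_ee_left, smul_eq_mul]
lemma dT_apply (i : Fin 3) (x v : V3) : dT i x v = (2 * NN i x)⁻¹ * v i - TT i x / NN i x * dN i x v := by
  simp only [dT, smul_apply, sub_apply, innerSL_apply_apply, inner_ee_left, smul_eq_mul]

lemma hasFDerivAt_coord (i : Fin 3) (x : V3) : HasFDerivAt (fun x : V3 => x i) (innerSL ℝ (ee i)) x := by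
  have := (innerSL ℝ (ee i)).hasFDerivAt (x := x)
  refine this.congr_of_eventuallyEq (Filter.Eventually.of_forall fun y => ?_)
  simp only [innerSL_apply_apply, inner_ee_left]

lemma hasFDerivAt_nsq (x : V3) : HasFDerivAt (fun x : V3 => ‖x‖^2) ((2:ℝ) • innerSL ℝ x) x := by
  have := (hasStrictFDerivAt_norm_sq x).hasFDerivAt
  refine this.congr_fderiv ?_
  ext v; simp

lemma hasFDerivAt_NN (i : Fin 3) {x : V3} (hx : x ≠ 0) : HasFDerivAt (NN i) (dN i x) x := by
  have h := ((hasFDerivAt_nsq x).sub (((hasFDerivAt_coord i x).pow 2).const_mul (3/4))).sqrt (NN_arg_pos i hx).ne'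
  refine h.congr_fderiv ?_
  have := NN_pos i hx
  ext v
  change _ = dN i x v
  rw [dN_apply]
  have e : √(‖x‖ ^ 2 - 3 / 4 * x.ofLp i ^ 2) = NN i x := rfl
  simp [inner_ee_left, e]
  field_simp

lemma hasFDerivAt_TT (i : Fin 3) {x : V3} (hx : x ≠ 0) : HasFDerivAt (TT i) (dT i x) x := by
  have hN := NN_pos i hx
  have h := hdiv (hasFDerivAt_coord i x) ((hasFDerivAt_NN i hx).const_mul 2) (by positivity)
  refine h.congr_fderiv ?_
  ext v
  rw [dT_apply]
  simp [inner_ee_left, TT]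
  field_simp

noncomputable def uI (i : Fin 3) (x : V3) : ℝ := (‖x‖^2 - 5/4 * (x i)^2) / (√2 * NN i x)

lemma hasFDerivAt_uI (i : Fin 3) {x : V3} (hx : x ≠ 0) :
    HasFDerivAt (uI i) (innerSL ℝ ((√2)⁻¹ • gg i x)) x := by
  have hN := NN_pos i hx
  have h2 := s2pos
  have h := hdiv ((hasFDerivAt_nsq x).sub (((hasFDerivAt_coord i x).pow 2).const_mul (5/4)))
    ((hasFDerivAt_NN i hx).const_mul √2) (by positivity)
  refine h.congr_fderiv ?_
  ext v
  have hq := norm_sq_NN i hx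
  have hc := two_TT_NN i hx
  rw [innerSL_apply_apply, real_inner_smul_left, gg, inner_sub_left, real_inner_smul_left, real_inner_smul_left,
    inner_ee_left]
  simp [inner_ee_left, dN_apply]
  rw [hq, hc]
  field_simp
  ring

lemma dN_self (i : Fin 3) {x : V3} (hx : x ≠ 0) : dN i x x = NN i x := by
  have hN := NN_pos i hx
  rw [dN_apply, real_inner_self_eq_norm_sq]
  have := NN_sq i x
  field_simp
  linarith
lemma dT_self (i : Fin 3) {x : V3} (hx : x ≠ 0) : dT i x x = 0 := by
  have hN := NN_pos i hx
  rw [dT_apply, dN_self i hx, two_TT_NN i hx]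
  field_simp
  ring
lemma dT_ee (i : Fin 3) {x : V3} (hx : x ≠ 0) : dT i x (ee i) = (1 - TT i x ^2) / (2 * NN i x) := by
  have hN := NN_pos i hx
  rw [dT_apply, dN_apply, ee_self, inner_ee_right, two_TT_NN i hx]
  field_simp
  ring

lemma sum_ee (x : V3) : ∑ j, x j • ee j = x := by
  ext k
  simp [ee, Finset.sum_apply, Pi.single_apply]

lemma div_gen {a c : V3 → ℝ} {a' c' : V3 →L[ℝ] ℝ} {x : V3} (i : Fin 3) (ha : HasFDerivAt a a' x)
    (hc : HasFDerivAt c c' x) :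
    ∑ j, (fderiv ℝ (fun x => a x • x - c x • ee i) x (ee j)) j = 3 * a x + a' x - c' (ee i) := by
  have h := (ha.fun_smul (hasFDerivAt_id x)).sub (hc.fun_smul (hasFDerivAt_const (ee i) x))
  have h' : HasFDerivAt (fun x => a x • x - c x • ee i) _ x := h
  rw [h'.fderiv]
  have e1 : a' x = ∑ j, x j * a' (ee j) := by
    conv_lhs => rw [← sum_ee x, map_sum]
    simp
  have e2 : c' (ee i) = ∑ j, c' (ee j) * ee i j := by
    simp [ee, Pi.single_apply]
  rw [e1, e2]
  simp only [Fin.sum_univ_three]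
  simp [ee_self]
  ring

lemma div_rr {β J : ℝ → ℝ} (hβ : ContDiff ℝ (⊤:ℕ∞) β) (hJ : ∀ t, HasDerivAt J (2 * β t) t) (i : Fin 3)
    {x : V3} (hx : x ≠ 0) : ∑ j, (fderiv ℝ (rr β J i) x (ee j)) j = 0 := by
  have hN := NN_pos i hx
  have hT := hasFDerivAt_TT i hx
  have hB : ContDiff ℝ (⊤:ℕ∞) (fun t => (1 - t^2) * β t) := by fun_prop
  have hb : HasDerivAt (fun t => (1 - t^2) * β t) (deriv (fun t => (1 - t^2) * β t) (TT i x)) (TT i x) :=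
    (hB.differentiable (by simp)).differentiableAt.hasDerivAt
  have ha := hdiv (hb.comp_hasFDerivAt x hT) (hasFDerivAt_NN i hx) hN.ne'
  have hc := ((hJ (TT i x)).comp_hasFDerivAt x hT).const_mul 2
  have := div_gen i ha hc
  refine Eq.trans this ?_
  simp only [smul_apply, sub_apply, dT_self i hx, dN_self i hx, dT_ee i hx, smul_eq_mul, Function.comp]
  field_simp
  ring
end

section
open Real Set Metric MeasureTheory
open scoped RealInnerProductSpace Topology

lemma hom_bdd {r : V3 → V3} (hr : ContDiffOn ℝ (⊤:ℕ∞) r {0}ᶜ) (hh : ∀ c : ℝ, 0 < c → ∀ x, r (c • x) = r x) :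
    ∃ C, ∀ x, x ≠ 0 → ‖r x‖ ≤ C := by
  have hs : sphere (0:V3) 1 ⊆ {0}ᶜ := by
    intro x hx h
    rw [mem_singleton_iff] at h
    subst h
    simp at hx
  obtain ⟨C, hC⟩ := (isCompact_sphere (0:V3) 1).exists_bound_of_continuousOn (hr.continuousOn.mono hs)
  refine ⟨C, fun x hx => ?_⟩
  rw [← hh (‖x‖⁻¹) (by positivity) x]
  apply hC
  rw [mem_sphere_zero_iff_norm, norm_smul, norm_inv, norm_norm, inv_mul_cancel₀ (norm_ne_zero_iff.2 hx)]

lemma fderiv_expand (L : V3 →L[ℝ] ℝ) (v : V3) : L v = ∑ j, v j * L (ee j) := by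
  conv_lhs => rw [← sum_ee v, map_sum]
  simp

lemma ibp {R : V3 → V3} (hR : ContDiff ℝ (⊤:ℕ∞) R) {φ : V3 → ℝ} (hφ : ContDiff ℝ (⊤:ℕ∞) φ)
    (hc : HasCompactSupport φ) :
    ∫ x, fderiv ℝ φ x (R x) = - ∫ x, (∑ j, (fderiv ℝ R x (ee j)) j) * φ x := by
  have hR' : ∀ j, ContDiff ℝ (⊤:ℕ∞) (fun x => R x j) := contDiff_euclidean.1 hR
  have hRd : ∀ j x, fderiv ℝ (fun x => R x j) x (ee j) = (fderiv ℝ R x (ee j)) j := by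
    intro j x
    have h1 : HasFDerivAt R (fderiv ℝ R x) x := (hR.differentiable (by simp)).differentiableAt.hasFDerivAt
    have h2 := (hasFDerivAt_coord j (R x)).comp x h1
    have h3 : HasFDerivAt (fun x => R x j) _ x := h2
    rw [h3.fderiv]
    simp [inner_ee_left]
  have cRd : ∀ j, Continuous fun x => (fderiv ℝ R x (ee j)) j := by
    intro j
    simp only [← hRd]
    exact ((hR' j).continuous_fderiv (by simp)).clm_apply continuous_const
  have cφ : ∀ j, Continuous fun x => fderiv ℝ φ x (ee j) := fun j =>
    (hφ.continuous_fderiv (by simp)).clm_apply continuous_const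
  have sφ : ∀ j, HasCompactSupport fun x => fderiv ℝ φ x (ee j) := fun j => hc.fderiv_apply ℝ _
  have i1 : ∀ j, Integrable (fun x => R x j * fderiv ℝ φ x (ee j)) := fun j =>
    (((hR' j).continuous).mul (cφ j)).integrable_of_hasCompactSupport (sφ j).mul_left
  have i2 : ∀ j, Integrable (fun x => fderiv ℝ (fun x => R x j) x (ee j) * φ x) := fun j => by
    simp only [hRd]
    exact ((cRd j).mul hφ.continuous).integrable_of_hasCompactSupport hc.mul_left
  have i3 : ∀ j, Integrable (fun x => R x j * φ x) := fun j =>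
    (((hR' j).continuous).mul hφ.continuous).integrable_of_hasCompactSupport hc.mul_left
  have key : ∀ j, ∫ x, R x j * fderiv ℝ φ x (ee j) = - ∫ x, (fderiv ℝ R x (ee j)) j * φ x := by
    intro j
    simp only [← hRd]
    exact integral_mul_fderiv_eq_neg_fderiv_mul_of_integrable (i2 j) (i1 j) (i3 j)
      (fun x _ => (hR' j).differentiable (by simp) x) (fun x _ => hφ.differentiable (by simp) x)
  simp only [fderiv_expand _ (R _), Finset.sum_mul]
  rw [integral_finsetSum _ (fun j _ => i1 j), integral_finsetSum, ← Finset.sum_neg_distrib]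
  · exact Finset.sum_congr rfl fun j _ => key j
  · intro j _
    simpa only [hRd] using i2 j

theorem divfree {r : V3 → V3} (hr : ContDiffOn ℝ (⊤:ℕ∞) r {0}ᶜ) (hh : ∀ c : ℝ, 0 < c → ∀ x, r (c • x) = r x)
    (hdiv : ∀ x, x ≠ 0 → ∑ j, (fderiv ℝ r x (ee j)) j = 0) {φ : V3 → ℝ} (hφ : ContDiff ℝ (⊤:ℕ∞) φ)
    (hc : HasCompactSupport φ) : ∫ x, fderiv ℝ φ x (r x) = 0 := by
  obtain ⟨R, hR, eR⟩ := cut hr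
  obtain ⟨C1, hC1⟩ := hom_bdd hr hh
  obtain ⟨C2, hC2⟩ := (isCompact_closedBall (0:V3) (1/2)).exists_bound_of_continuousOn hR.continuous.continuousOn
  set C := max C1 C2 with hCdef
  have hC : ∀ x, ‖R x‖ ≤ C := by
    intro x
    rcases le_total ‖x‖ (1/2) with h | h
    · exact (hC2 x (by simpa using h)).trans (le_max_right _ _)
    · rw [eR x h]
      exact (hC1 x (by rintro rfl; norm_num at h)).trans (le_max_left _ _)
  set G : V3 → ℝ := fun x => ∑ j, (fderiv ℝ R x (ee j)) j with hG
  have hGc : Continuous G := by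
    refine continuous_finsetSum _ fun j _ => ?_
    have : Continuous fun x => fderiv ℝ R x (ee j) := (hR.continuous_fderiv (by simp)).clm_apply continuous_const
    exact (contDiff_euclidean (n := 0).1 contDiff_id j).continuous.comp this
  have hGs : HasCompactSupport G := by
    refine HasCompactSupport.intro (isCompact_closedBall (0:V3) (1/2)) fun x hx => ?_
    have hx' : 1/2 < ‖x‖ := by simpa using hx
    have : R =ᶠ[𝓝 x] r := by
      filter_upwards [(continuous_norm.continuousAt (x := x)).eventually_const_lt hx'] with y hy
      exact eR y hy.le
    simp only [hG, this.fderiv_eq]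
    exact hdiv x (by rintro rfl; norm_num at hx')
  obtain ⟨M, hM⟩ := hc.exists_bound_of_continuous hφ.continuous
  have hM0 : 0 ≤ M := (norm_nonneg _).trans (hM 0)
  -- scaled fields
  have hint : ∀ n : ℕ, ‖∫ x, fderiv ℝ φ x (R (((n:ℝ)+1) • x))‖ ≤ (M * ∫ x, ‖G x‖) * (1 / ((n:ℝ)+1)) := by
    intro n
    set c : ℝ := (n:ℝ)+1 with hcdef
    have hc1 : 1 ≤ c := by rw [hcdef]; linarith [n.cast_nonneg (α := ℝ)]
    have hRc : ContDiff ℝ (⊤:ℕ∞) (fun x => R (c • x)) := hR.comp (contDiff_const_smul c)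
    have hd : ∀ x, ∑ j, (fderiv ℝ (fun x => R (c • x)) x (ee j)) j = c * G (c • x) := by
      intro x
      simp only [hG, Finset.mul_sum]
      refine Finset.sum_congr rfl fun j _ => ?_
      rw [fderiv_comp_smul]
      simp
    rw [ibp hRc hφ hc, norm_neg]
    simp only [hd]
    have hGi : Integrable G := hGc.integrable_of_hasCompactSupport hGs
    have hGi' : Integrable (fun x => ‖G (c • x)‖) := (hGi.comp_smul (by positivity)).norm
    calc _ ≤ ∫ x, (c * M) * ‖G (c • x)‖ := by
          refine norm_integral_le_of_norm_le (hGi'.const_mul _) (Filter.Eventually.of_forall fun x => ?_)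
          rw [norm_mul, norm_mul, Real.norm_of_nonneg (by positivity : 0 ≤ c)]
          have := hM x
          have h0 : 0 ≤ c * ‖G (c • x)‖ := by positivity
          nlinarith
      _ = (M * ∫ x, ‖G x‖) * (1 / c^2) := by
          rw [integral_const_mul, Measure.integral_comp_smul volume (fun x => ‖G x‖) c]
          simp only [finrank_euclideanSpace, Fintype.card_fin, smul_eq_mul]
          rw [abs_of_nonneg (by positivity)]
          field_simp
      _ ≤ _ := by
          have : 0 ≤ ∫ x, ‖G x‖ := integral_nonneg fun _ => norm_nonneg _
          gcongr
          nlinarith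
  have lim0 : Filter.Tendsto (fun n : ℕ => ∫ x, fderiv ℝ φ x (R (((n:ℝ)+1) • x))) Filter.atTop (𝓝 0) := by
    refine squeeze_zero_norm hint ?_
    simpa using tendsto_one_div_add_atTop_nhds_zero_nat.const_mul (M * ∫ x, ‖G x‖)
  have lim1 : Filter.Tendsto (fun n : ℕ => ∫ x, fderiv ℝ φ x (R (((n:ℝ)+1) • x))) Filter.atTop
      (𝓝 (∫ x, fderiv ℝ φ x (r x))) := by
    have hdφ : Continuous (fderiv ℝ φ) := hφ.continuous_fderiv (by simp)
    refine tendsto_integral_of_dominated_convergence (fun x => ‖fderiv ℝ φ x‖ * C) ?_ ?_ ?_ ?_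
    · intro n
      exact (hdφ.clm_apply (hR.continuous.comp (by fun_prop))).aestronglyMeasurable
    · exact ((hdφ.integrable_of_hasCompactSupport (hc.fderiv ℝ)).norm).mul_const _
    · intro n
      exact Filter.Eventually.of_forall fun x => ((fderiv ℝ φ x).le_opNorm _).trans (by gcongr; exact hC _)
    · have : ∀ᵐ x : V3, x ≠ 0 := by
        rw [ae_iff]; simp
      filter_upwards [this] with x hx
      refine tendsto_const_nhds.congr' ?_
      have hx' : 0 < ‖x‖ := norm_pos_iff.2 hx
      obtain ⟨n0, hn0⟩ := exists_nat_gt (1 / (2 * ‖x‖))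
      filter_upwards [Filter.eventually_ge_atTop n0] with n hn
      have hn' : (n0:ℝ) ≤ n := by exact_mod_cast hn
      have hcp : 0 < (n:ℝ) + 1 := by positivity
      rw [eR, hh _ hcp]
      rw [norm_smul, Real.norm_of_nonneg hcp.le]
      rw [div_lt_iff₀ (by positivity)] at hn0
      nlinarith
  exact tendsto_nhds_unique lim1 lim0
end

section
open Real Set Metric MeasureTheory
open scoped RealInnerProductSpace Topology

lemma NN_smul (i : Fin 3) {c : ℝ} (hc : 0 < c) (x : V3) : NN i (c • x) = c * NN i x := by
  unfold NN
  rw [norm_smul, PiLp.smul_apply, Real.norm_of_nonneg hc.le, smul_eq_mul,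
    show (c * ‖x‖)^2 - 3/4 * (c * x i)^2 = c^2 * (‖x‖^2 - 3/4 * (x i)^2) by ring,
    Real.sqrt_mul (by positivity), Real.sqrt_sq hc.le]

lemma TT_smul (i : Fin 3) {c : ℝ} (hc : 0 < c) (x : V3) : TT i (c • x) = TT i x := by
  unfold TT
  rw [NN_smul i hc, PiLp.smul_apply, smul_eq_mul, show 2 * (c * NN i x) = c * (2 * NN i x) by ring,
    mul_div_mul_left _ _ hc.ne']

lemma gg_smul (i : Fin 3) {c : ℝ} (hc : 0 < c) (x : V3) : gg i (c • x) = gg i x := by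
  unfold gg
  rw [TT_smul i hc, NN_smul i hc, smul_smul]
  congr 2
  rw [div_mul_eq_mul_div, mul_comm _ c, mul_div_mul_left _ _ hc.ne']

lemma rr_smul (β J : ℝ → ℝ) (i : Fin 3) {c : ℝ} (hc : 0 < c) (x : V3) : rr β J i (c • x) = rr β J i x := by
  unfold rr
  rw [TT_smul i hc, NN_smul i hc, smul_smul]
  congr 2
  rw [div_mul_eq_mul_div, mul_comm _ c, mul_div_mul_left _ _ hc.ne']

lemma u1_eq : u1 = uI 0 := by
  ext x
  have h := EuclideanSpace.norm_sq_eq x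
  simp only [Fin.sum_univ_three, Real.norm_eq_abs, sq_abs] at h
  simp only [uI, NN, h]
  simp only [u1, u0, EuclideanSpace.norm_eq, Fin.sum_univ_three, Real.norm_eq_abs, sq_abs]
  simp
  congr 1
  · ring
  · congr 2; ring

lemma u2_eq : u2 = uI 2 := by
  ext x
  have h := EuclideanSpace.norm_sq_eq x
  simp only [Fin.sum_univ_three, Real.norm_eq_abs, sq_abs] at h
  simp only [uI, NN, h]
  simp only [u2, u0, EuclideanSpace.norm_eq, Fin.sum_univ_three, Real.norm_eq_abs, sq_abs]
  simp
  congr 1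
  · ring
  · congr 2; ring

lemma Du_apply {v : V3 → EuclideanSpace ℝ (Fin 2)} {x : V3} {L : Fin 2 → V3 →L[ℝ] ℝ}
    (h : ∀ k, HasFDerivAt (fun x => v x k) (L k) x) (k : Fin 2) (j : Fin 3) :
    Du v x (k, j) = L k (ee j) := by
  have hd : DifferentiableAt ℝ v x := differentiableAt_euclidean.2 fun k => (h k).differentiableAt
  have h1 : HasFDerivAt (fun x => v x k) (((PiLp.proj 2 (fun _ : Fin 2 => ℝ) k : _ →L[ℝ] ℝ)).comp (fderiv ℝ v x)) x :=
    (PiLp.proj 2 (fun _ : Fin 2 => ℝ) k : _ →L[ℝ] ℝ).hasFDerivAt.comp x hd.hasFDerivAt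
  rw [(h k).unique h1]
  simp [Du, ee]

lemma Du_uu {x : V3} (hx : x ≠ 0) : Du uu x = YY x := by
  ext ⟨k, j⟩
  rw [Du_apply (L := ![innerSL ℝ ((√2)⁻¹ • gg 0 x), innerSL ℝ ((√2)⁻¹ • gg 2 x)])]
  · fin_cases k
    · simp [YY, mkE, inner_ee_right, real_inner_smul_left]
    · simp [YY, mkE, inner_ee_right, real_inner_smul_left]
  · intro k
    fin_cases k
    · have := hasFDerivAt_uI 0 hx
      rw [← u1_eq] at this
      exact this
    · have := hasFDerivAt_uI 2 hx
      rw [← u2_eq] at this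
      exact this

lemma aesm {W : Type*} [NormedAddCommGroup W] [SecondCountableTopology W] {g : V3 → W}
    (hg : ContinuousOn g {0}ᶜ) : AEStronglyMeasurable g (volume : Measure V3) := by
  have := hg.aestronglyMeasurable (μ := volume) (measurableSet_singleton (0:V3)).compl
  rwa [restrict_compl_singleton] at this

lemma ae_ne : ∀ᵐ x : V3, x ≠ 0 := by
  rw [ae_iff]; simp

lemma int_pair {r : V3 → V3} (hr : ContDiffOn ℝ (⊤:ℕ∞) r {0}ᶜ) (hh : ∀ c : ℝ, 0 < c → ∀ x, r (c • x) = r x)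
    {φ : V3 → ℝ} (hφ : ContDiff ℝ (⊤:ℕ∞) φ) (hc : HasCompactSupport φ) :
    Integrable fun x => fderiv ℝ φ x (r x) := by
  obtain ⟨C, hC⟩ := hom_bdd hr hh
  have hdφ : Continuous (fderiv ℝ φ) := hφ.continuous_fderiv (by simp)
  refine Integrable.mono' (((hdφ.integrable_of_hasCompactSupport (hc.fderiv ℝ)).norm).mul_const C)
    (aesm (hdφ.continuousOn.clm_apply hr.continuousOn)) ?_
  filter_upwards [ae_ne] with x hx
  exact ((fderiv ℝ φ x).le_opNorm _).trans (by gcongr; exact hC _ hx)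

theorem final_aux : ∃ F : EuclideanSpace ℝ (Fin 2 × Fin 3) → ℝ, ∃ γ Λ : ℝ,
      ContDiff ℝ (⊤ : ℕ∞) F ∧ 0 < γ ∧ γ ≤ Λ ∧
      (∀ P Q : EuclideanSpace ℝ (Fin 2 × Fin 3),
        γ * ‖Q - P‖ ^ 2 ≤ F Q - F P - ⟪gradient F P, Q - P⟫ ∧
          F Q - F P - ⟪gradient F P, Q - P⟫ ≤ Λ * ‖Q - P‖ ^ 2) ∧
      (∀ ψ : EuclideanSpace ℝ (Fin 3) → EuclideanSpace ℝ (Fin 2),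
        ContDiff ℝ (⊤ : ℕ∞) ψ → HasCompactSupport ψ →
        tsupport ψ ⊆ ball (0 : EuclideanSpace ℝ (Fin 3)) 1 →
        ∫ x in ball (0 : EuclideanSpace ℝ (Fin 3)) 1, F (Du uu x) ≤
          ∫ x in ball (0 : EuclideanSpace ℝ (Fin 3)) 1, F (Du uu x + Du ψ x)) := by
  obtain ⟨β, J, hβ, hJ, hd, F, γ, Λ, hF, hγ, hΛ, hconv, hgrad⟩ := exists_F
  refine ⟨F, γ, Λ, hF, hγ, hΛ, ?_, ?_⟩
  · intro P Q
    have e : ⟪gradient F P, Q - P⟫ = fderiv ℝ F P (Q - P) := by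
      rw [gradient, InnerProductSpace.toDual_symm_apply]
    rw [e]
    exact hconv P Q
  intro ψ hψ hψc hψs
  have hk : ∀ k, ContDiff ℝ (⊤:ℕ∞) (fun x => ψ x k) := contDiff_euclidean.1 hψ
  have hkc : ∀ k, HasCompactSupport (fun x => ψ x k) := fun k =>
    hψc.mono (fun x hx h => hx (by simp only [h]; rfl))
  have hDψ : ∀ x k j, Du ψ x (k, j) = fderiv ℝ (fun x => ψ x k) x (ee j) := fun x k j =>
    Du_apply (L := fun k => fderiv ℝ (fun x => ψ x k) x)
      (fun k => ((hk k).differentiable (by simp)).differentiableAt.hasFDerivAt) k j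
  have hAin : ∀ x, ⟪AA β J x, Du ψ x⟫ = √2 * fderiv ℝ (fun x => ψ x 0) x (rr β J 0 x)
      + √2 * fderiv ℝ (fun x => ψ x 1) x (rr β J 2 x) := by
    intro x
    rw [fderiv_expand _ (rr β J 0 x), fderiv_expand _ (rr β J 2 x)]
    simp only [PiLp.inner_apply, Fintype.sum_prod_type, Fin.sum_univ_two, hDψ]
    simp [AA, mkE, Finset.mul_sum, mul_assoc, mul_comm, mul_left_comm]
  have hr := fun i => contDiffOn_rr hβ hJ i
  have hrh := fun i (c : ℝ) (hc : 0 < c) x => rr_smul β J i hc x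
  have I0 := int_pair (hr 0) (hrh 0) (hk 0) (hkc 0)
  have I1 := int_pair (hr 2) (hrh 2) (hk 1) (hkc 1)
  have Z0 := divfree (hr 0) (hrh 0) (fun x hx => div_rr hβ hd 0 hx) (hk 0) (hkc 0)
  have Z1 := divfree (hr 2) (hrh 2) (fun x hx => div_rr hβ hd 2 hx) (hk 1) (hkc 1)
  have hAi : Integrable fun x => ⟪AA β J x, Du ψ x⟫ := by
    simp only [hAin]
    exact (I0.const_mul _).add (I1.const_mul _)
  have hA0 : ∫ x in ball (0:V3) 1, ⟪AA β J x, Du ψ x⟫ = 0 := by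
    rw [setIntegral_eq_integral_of_forall_compl_eq_zero]
    · simp only [hAin]
      rw [integral_add (I0.const_mul _) (I1.const_mul _), integral_const_mul, integral_const_mul, Z0, Z1]
      simp
    · intro x hx
      have : Du ψ x = 0 := by
        have h0 : fderiv ℝ ψ x = 0 := by
          by_contra h
          exact hx (hψs (support_fderiv_subset ℝ h))
        ext p
        simp [Du, h0]
      rw [this, inner_zero_right]
  -- pointwise
  have hpt : ∀ x : V3, x ≠ 0 → F (Du uu x) + ⟪AA β J x, Du ψ x⟫ ≤ F (Du uu x + Du ψ x) := by
    intro x hx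
    have hp : 0 < ‖x‖⁻¹ := by positivity
    have hs : ‖x‖⁻¹ • x ∈ sphere (0:V3) 1 := by
      rw [mem_sphere_zero_iff_norm, norm_smul, norm_inv, norm_norm, inv_mul_cancel₀ (norm_ne_zero_iff.2 hx)]
    have h1 := hgrad _ hs
    have eY : YY (‖x‖⁻¹ • x) = YY x := by unfold YY; rw [gg_smul 0 hp, gg_smul 2 hp]
    have eA : AA β J (‖x‖⁻¹ • x) = AA β J x := by unfold AA; rw [rr_smul β J 0 hp, rr_smul β J 2 hp]
    rw [eY, eA] at h1
    rw [Du_uu hx]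
    have h2 := (hconv (YY x) (YY x + Du ψ x)).1
    rw [add_sub_cancel_left, h1, innerSL_apply_apply] at h2
    have : 0 ≤ γ * ‖Du ψ x‖^2 := by positivity
    linarith
  -- bounds
  have hYb : ∃ C, ∀ x : V3, x ≠ 0 → ‖YY x‖ ≤ C := by
    obtain ⟨C, hC⟩ := (isCompact_sphere (0:V3) 1).exists_bound_of_continuousOn
      (contDiffOn_YY.continuousOn.mono sphere_sub)
    refine ⟨C, fun x hx => ?_⟩
    have hp : 0 < ‖x‖⁻¹ := by positivity
    have eY : YY (‖x‖⁻¹ • x) = YY x := by unfold YY; rw [gg_smul 0 hp, gg_smul 2 hp]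
    rw [← eY]
    apply hC
    rw [mem_sphere_zero_iff_norm, norm_smul, norm_inv, norm_norm, inv_mul_cancel₀ (norm_ne_zero_iff.2 hx)]
  obtain ⟨C, hC⟩ := hYb
  have hDc : Continuous (Du ψ) := by
    refine (PiLp.continuous_toLp 2 _).comp (continuous_pi ?_)
    rintro ⟨k, j⟩
    have : Continuous fun x => Du ψ x (k, j) := by
      simp only [hDψ]
      exact ((hk k).continuous_fderiv (by simp)).clm_apply continuous_const
    exact this
  have integ : ∀ D : V3 → E6, Continuous D → IntegrableOn (fun x => F (Du uu x + D x)) (ball (0:V3) 1) := by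
    intro D hD
    obtain ⟨C', hC'⟩ := (isCompact_closedBall (0:V3) 1).exists_bound_of_continuousOn hD.continuousOn
    obtain ⟨M, hM⟩ := (isCompact_closedBall (0:E6) (C + C')).exists_bound_of_continuousOn hF.continuous.continuousOn
    have m1 : AEStronglyMeasurable (fun x => F (YY x + D x)) (volume : Measure V3) :=
      aesm (hF.continuous.comp_continuousOn (contDiffOn_YY.continuousOn.add hD.continuousOn))
    have m2 : AEStronglyMeasurable (fun x => F (Du uu x + D x)) (volume : Measure V3) := by
      refine m1.congr ?_
      filter_upwards [ae_ne] with x hx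
      rw [Du_uu hx]
    refine IntegrableOn.of_bound measure_ball_lt_top m2.restrict M ?_
    rw [ae_restrict_iff' measurableSet_ball]
    filter_upwards [ae_ne] with x hx hxb
    apply hM
    rw [mem_closedBall_zero_iff, Du_uu hx]
    exact (norm_add_le _ _).trans (add_le_add (hC x hx) (hC' x (ball_subset_closedBall hxb)))
  have i1 := integ (Du ψ) hDc
  have i0 : IntegrableOn (fun x => F (Du uu x)) (ball (0:V3) 1) := by
    simpa using integ (fun _ => 0) continuous_const
  calc ∫ x in ball (0:V3) 1, F (Du uu x) = ∫ x in ball (0:V3) 1, (F (Du uu x) + ⟪AA β J x, Du ψ x⟫) := by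
        rw [integral_add i0 hAi.integrableOn, hA0, add_zero]
    _ ≤ _ := by
        refine integral_mono_ae (i0.add hAi.integrableOn) i1 ?_
        exact ae_restrict_of_ae (by filter_upwards [ae_ne] with x hx using hpt x hx)
end

/-- There is a smooth, uniformly convex `F` with bounded Hessian on `ℝ^(2×3)` for which the
Lipschitz map `u = (u¹,u²)` minimizes `∫_{B₁} F(Du) dx`. -/
theorem statement0 :
    ∃ F : EuclideanSpace ℝ (Fin 2 × Fin 3) → ℝ, ∃ γ Λ : ℝ,
      ContDiff ℝ (⊤ : ℕ∞) F ∧ 0 < γ ∧ γ ≤ Λ ∧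
      (∀ P Q : EuclideanSpace ℝ (Fin 2 × Fin 3),
        γ * ‖Q - P‖ ^ 2 ≤ F Q - F P - ⟪gradient F P, Q - P⟫ ∧
          F Q - F P - ⟪gradient F P, Q - P⟫ ≤ Λ * ‖Q - P‖ ^ 2) ∧
      (∀ ψ : EuclideanSpace ℝ (Fin 3) → EuclideanSpace ℝ (Fin 2),
        ContDiff ℝ (⊤ : ℕ∞) ψ → HasCompactSupport ψ →
        tsupport ψ ⊆ ball (0 : EuclideanSpace ℝ (Fin 3)) 1 →
        ∫ x in ball (0 : EuclideanSpace ℝ (Fin 3)) 1, F (Du uu x) ≤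
          ∫ x in ball (0 : EuclideanSpace ℝ (Fin 3)) 1, F (Du uu x + Du ψ x)) := by
  exact final_aux
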